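/- The operator M = A + B is LCP at all points (x,t) ∈ (0,∞)ⁿ × [0,T] if and only if both operators A and B are LCP at all points (x,t) ∈ (0,∞)ⁿ × [0,T]. -/

import Mathlib

open MeasureTheory Set Matrix NNReal

noncomputable section

/-- The open positive orthant `(0,∞)ⁿ` in `ℝⁿ`. -/
def posOrth (n : ℕ) : Set (Fin n → ℝ) := {x | ∀ i, 0 < x i}

/-- First directional derivative of `f` at `x` in direction `v`. -/
def dir1 {n : ℕ} {F : Type*} [NormedAddCommGroup F] [NormedSpace ℝ F]
    (f : (Fin n → ℝ) → F) (x v : Fin n → ℝ) : F :=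
  fderiv ℝ f x v

/-- Mixed second derivative: differentiate `f` in direction `v`, then in direction `w`. -/
def dmix {n : ℕ} {F : Type*} [NormedAddCommGroup F] [NormedSpace ℝ F]
    (f : (Fin n → ℝ) → F) (x v w : Fin n → ℝ) : F :=
  fderiv ℝ (fun y => fderiv ℝ f y v) x w

/-- Second directional derivative of `f` at `x` in direction `v`. -/
def dir2 {n : ℕ} {F : Type*} [NormedAddCommGroup F] [NormedSpace ℝ F]
    (f : (Fin n → ℝ) → F) (x v : Fin n → ℝ) : F :=
  dmix f x v v

/-- The class `F` of test functions: `C⁴` on the positive orthant, with locally Hölder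
continuous fourth derivatives, and with `f` together with its derivatives up to order two
of at most polynomial growth. -/
structure MemTestClass (n : ℕ) (f : (Fin n → ℝ) → ℝ) : Prop where
  smooth : ContDiffOn ℝ 4 f (posOrth n)
  holder4 : ∃ α : ℝ≥0, 0 < α ∧ (α : ℝ) ≤ 1 ∧
    ∀ x ∈ posOrth n, ∃ s ∈ nhds x, s ⊆ posOrth n ∧
      ∃ C : ℝ≥0, HolderOnWith C α (iteratedFDeriv ℝ 4 f) s
  polyGrowth : ∃ C m : ℝ, ∀ x ∈ posOrth n, ∀ k : ℕ, k ≤ 2 →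
    ‖iteratedFDeriv ℝ k f x‖ ≤ C * (1 + ‖x‖ ^ m)

/-- The jump structure `φ(x,t,z)` together with the standing assumptions (A3), (A6), (A7). -/
structure JumpKernel (n : ℕ) (T : ℝ) where
  φ : (Fin n → ℝ) → ℝ → ℝ → (Fin n → ℝ)
  meas : ∀ x ∈ posOrth n, ∀ t ∈ Icc (0:ℝ) T, Measurable (fun z => φ x t z)
  smooth : ∀ t ∈ Icc (0:ℝ) T, ∀ z ∈ Icc (0:ℝ) 1,
    ContDiffOn ℝ 2 (fun x => φ x t z) (posOrth n)
  holder2 : ∃ α : ℝ≥0, 0 < α ∧ (α : ℝ) ≤ 1 ∧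
    ∀ t ∈ Icc (0:ℝ) T, ∀ x ∈ posOrth n, ∃ s ∈ nhds x, s ⊆ posOrth n ∧
      ∃ C : ℝ≥0, ∀ z ∈ Icc (0:ℝ) 1,
        HolderOnWith C α (iteratedFDeriv ℝ 2 (fun y => φ y t z)) s
  bound : ∃ D : ℝ, 0 < D ∧ ∀ x ∈ posOrth n, ∀ t ∈ Icc (0:ℝ) T, ∀ z ∈ Icc (0:ℝ) 1,
    ∀ i, (φ x t z i) ^ 2 ≤ D * (x i) ^ 2
  lower : ∃ γ₀ : ℝ, -1 < γ₀ ∧ ∀ x ∈ posOrth n, ∀ t ∈ Icc (0:ℝ) T, ∀ z ∈ Icc (0:ℝ) 1,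
    ∀ i, γ₀ * x i < φ x t z i

/-- For each fixed `(x,t)`, `φ(x,t,z) ≠ 0` for almost every `z ∈ [0,1]`. -/
def JumpKernel.AENonzero {n : ℕ} {T : ℝ} (K : JumpKernel n T) : Prop :=
  ∀ x ∈ posOrth n, ∀ t ∈ Icc (0:ℝ) T,
    ∀ᵐ z ∂(volume.restrict (Icc (0:ℝ) 1)), K.φ x t z ≠ 0

/-- The jump intensity `λ` : nonnegative and Hölder continuous on `[0,T]`. -/
def LamOK (T : ℝ) (lam : ℝ → ℝ) : Prop :=
  (∀ t ∈ Icc (0:ℝ) T, 0 ≤ lam t) ∧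
  ∃ α C : ℝ≥0, 0 < α ∧ (α : ℝ) ≤ 1 ∧ HolderOnWith C α lam (Icc (0:ℝ) T)

/-- The integro-differential jump operator `B`. -/
def Bop {n : ℕ} {T : ℝ} (lam : ℝ → ℝ) (K : JumpKernel n T)
    (f : (Fin n → ℝ) → ℝ) (x : Fin n → ℝ) (t : ℝ) : ℝ :=
  lam t * ∫ z in Icc (0:ℝ) 1,
    (f (x + K.φ x t z) - f x - fderiv ℝ f x (K.φ x t z))

/-- The diffusion matrix `β(x,t)` together with the standing assumptions (A1), (A3), (A5). -/
structure DiffKernel (n : ℕ) (T : ℝ) where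
  β : (Fin n → ℝ) → ℝ → Matrix (Fin n) (Fin n) ℝ
  smooth : ∀ t ∈ Icc (0:ℝ) T, ∀ i j, ContDiffOn ℝ 2 (fun x => β x t i j) (posOrth n)
  holder2 : ∃ α : ℝ≥0, 0 < α ∧ (α : ℝ) ≤ 1 ∧
    ∀ t ∈ Icc (0:ℝ) T, ∀ i j, ∀ x ∈ posOrth n, ∃ s ∈ nhds x, s ⊆ posOrth n ∧
      ∃ C : ℝ≥0, HolderOnWith C α (iteratedFDeriv ℝ 2 (fun y => β y t i j)) s
  nonsing : ∀ x ∈ posOrth n, ∀ t ∈ Icc (0:ℝ) T, (β x t).det ≠ 0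
  bound : ∃ D : ℝ, 0 < D ∧ ∀ x ∈ posOrth n, ∀ t ∈ Icc (0:ℝ) T,
    ∀ i, ∑ j, (β x t i j) ^ 2 ≤ D * (x i) ^ 2

/-- The second order differential operator `A` with coefficient matrix `a = ββ*/2`. -/
def Aop {n : ℕ} {T : ℝ} (Dk : DiffKernel n T)
    (f : (Fin n → ℝ) → ℝ) (x : Fin n → ℝ) (t : ℝ) : ℝ :=
  ∑ i, ∑ j, ((Dk.β x t * (Dk.β x t)ᵀ) i j / 2) *
    dmix f x (Pi.single i 1) (Pi.single j 1)

/-- An operator `D` (mapping a test function `f` to a function of `(x,t)`) is locally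
convexity preserving (LCP) at `(x,t)` if `∂_v²(Df)(x,t) ≥ 0` for every direction `v ≠ 0`
and every convex `f ∈ F` with `∂_v²f(x) = 0`. -/
def IsLCPAt {n : ℕ} (D : ((Fin n → ℝ) → ℝ) → (Fin n → ℝ) → ℝ → ℝ)
    (x : Fin n → ℝ) (t : ℝ) : Prop :=
  ∀ v : Fin n → ℝ, v ≠ 0 → ∀ f : (Fin n → ℝ) → ℝ,
    MemTestClass n f → ConvexOn ℝ (posOrth n) f → dir2 f x v = 0 →
    0 ≤ dir2 (fun y => D f y t) x v

/-- The integrand in condition (ohly) of Theorem 5.1. -/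
def ohlyIntegrand {n : ℕ} {T : ℝ} (K : JumpKernel n T)
    (f : (Fin n → ℝ) → ℝ) (x v : Fin n → ℝ) (t z : ℝ) : ℝ :=
  dmix f (x + K.φ x t z) v v
    + 2 * dmix f (x + K.φ x t z) v (dir1 (fun y => K.φ y t z) x v)
    + dmix f (x + K.φ x t z) (dir1 (fun y => K.φ y t z) x v)
        (dir1 (fun y => K.φ y t z) x v)
    + (fderiv ℝ f (x + K.φ x t z) (dir2 (fun y => K.φ y t z) x v)
        - fderiv ℝ f x (dir2 (fun y => K.φ y t z) x v))

section

open Filter Topology Metric ContDiff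

/-- The full second derivative of `f` at `x`. -/
def d2 {E F : Type*} [NormedAddCommGroup E] [NormedSpace ℝ E] [NormedAddCommGroup F]
    [NormedSpace ℝ F] (f : E → F) (x : E) : E →L[ℝ] E →L[ℝ] F :=
  fderiv ℝ (fderiv ℝ f) x

/-- `f` is differentiable near `x` and its derivative is differentiable at `x`. -/
def TwiceDiffAt {E F : Type*} [NormedAddCommGroup E] [NormedSpace ℝ E] [NormedAddCommGroup F]
    [NormedSpace ℝ F] (f : E → F) (x : E) : Prop :=
  (∀ᶠ y in 𝓝 x, DifferentiableAt ℝ f y) ∧ DifferentiableAt ℝ (fderiv ℝ f) x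

section TwiceDiff

variable {E F G : Type*} [NormedAddCommGroup E] [NormedSpace ℝ E] [NormedAddCommGroup F]
    [NormedSpace ℝ F] [NormedAddCommGroup G] [NormedSpace ℝ G]

theorem ContDiffAt.twiceDiffAt {f : E → F} {x : E} (h : ContDiffAt ℝ 2 f x) :
    TwiceDiffAt f x :=
  ⟨(h.eventually (by simp)).mono fun _ hy => hy.differentiableAt (by simp),
    (h.fderiv_right (m := 1) (by norm_num)).differentiableAt (by simp)⟩

theorem d2_congr {f g : E → F} {x : E} (h : f =ᶠ[𝓝 x] g) : d2 f x = d2 g x :=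
  (h.fderiv (𝕜 := ℝ)).fderiv_eq

theorem TwiceDiffAt.add {f g : E → F} {x : E} (hf : TwiceDiffAt f x) (hg : TwiceDiffAt g x) :
    TwiceDiffAt (fun y => f y + g y) x := by
  have h : fderiv ℝ (fun y => f y + g y) =ᶠ[𝓝 x] fun y => fderiv ℝ f y + fderiv ℝ g y := by
    filter_upwards [hf.1, hg.1] with y h1 h2 using fderiv_fun_add h1 h2
  refine ⟨?_, (hf.2.add hg.2).congr_of_eventuallyEq h⟩
  filter_upwards [hf.1, hg.1] with y h1 h2 using h1.add h2

theorem d2_add {f g : E → F} {x : E} (hf : TwiceDiffAt f x) (hg : TwiceDiffAt g x) :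
    d2 (fun y => f y + g y) x = d2 f x + d2 g x := by
  have h : fderiv ℝ (fun y => f y + g y) =ᶠ[𝓝 x] fun y => fderiv ℝ f y + fderiv ℝ g y := by
    filter_upwards [hf.1, hg.1] with y h1 h2 using fderiv_fun_add h1 h2
  rw [d2, h.fderiv_eq, fderiv_fun_add hf.2 hg.2]; rfl

theorem TwiceDiffAt.const_smul {f : E → F} {x : E} (hf : TwiceDiffAt f x) (c : ℝ) :
    TwiceDiffAt (fun y => c • f y) x := by
  have h : fderiv ℝ (fun y => c • f y) =ᶠ[𝓝 x] fun y => c • fderiv ℝ f y := by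
    filter_upwards [hf.1] with y h1 using fderiv_fun_const_smul h1 c
  refine ⟨?_, (hf.2.const_smul c).congr_of_eventuallyEq h⟩
  filter_upwards [hf.1] with y h1 using h1.const_smul c

theorem d2_const_smul {f : E → F} {x : E} (hf : TwiceDiffAt f x) (c : ℝ) :
    d2 (fun y => c • f y) x = c • d2 f x := by
  have h : fderiv ℝ (fun y => c • f y) =ᶠ[𝓝 x] fun y => c • fderiv ℝ f y := by
    filter_upwards [hf.1] with y h1 using fderiv_fun_const_smul h1 c
  rw [d2, h.fderiv_eq, fderiv_fun_const_smul hf.2]; rfl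

theorem d2_sub {f g : E → F} {x : E} (hf : TwiceDiffAt f x) (hg : TwiceDiffAt g x) :
    d2 (fun y => f y - g y) x = d2 f x - d2 g x := by
  have h := d2_add hf (hg.const_smul (-1))
  rw [d2_const_smul hg] at h
  ext v w
  simpa [sub_eq_add_neg] using DFunLike.congr_fun (DFunLike.congr_fun h v) w

theorem dmix_eq_d2 {n : ℕ} {f : (Fin n → ℝ) → F} {x : Fin n → ℝ}
    (hf : DifferentiableAt ℝ (fderiv ℝ f) x) (v w : Fin n → ℝ) : dmix f x v w = d2 f x w v := by
  rw [dmix, d2, fderiv_clm_apply hf (differentiableAt_const v)]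
  simp

theorem dir2_eq_d2 {n : ℕ} {f : (Fin n → ℝ) → F} {x : Fin n → ℝ}
    (hf : DifferentiableAt ℝ (fderiv ℝ f) x) (v : Fin n → ℝ) : dir2 f x v = d2 f x v v :=
  dmix_eq_d2 hf v v

/-- Second derivative of a composition. -/
theorem d2_comp {g : F → G} {m : E → F} {x : E} (hg : ContDiffAt ℝ 2 g (m x))
    (hm : ContDiffAt ℝ 2 m x) (v w : E) :
    d2 (fun y => g (m y)) x v w
      = d2 g (m x) (fderiv ℝ m x v) (fderiv ℝ m x w) + fderiv ℝ g (m x) (d2 m x v w) := by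
  have h : fderiv ℝ (fun y => g (m y)) =ᶠ[𝓝 x] fun y => (fderiv ℝ g (m y)).comp (fderiv ℝ m y) := by
    filter_upwards [hm.twiceDiffAt.1, hm.continuousAt.eventually hg.twiceDiffAt.1] with y h1 h2
    exact fderiv_comp y h2 h1
  have hm1 : DifferentiableAt ℝ m x := hm.differentiableAt (by simp)
  have h1 : HasFDerivAt (fun y => fderiv ℝ g (m y)) ((d2 g (m x)).comp (fderiv ℝ m x)) x :=
    HasFDerivAt.comp x hg.twiceDiffAt.2.hasFDerivAt hm1.hasFDerivAt
  have h2 : HasFDerivAt (fderiv ℝ m) (d2 m x) x := hm.twiceDiffAt.2.hasFDerivAt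
  rw [d2, h.fderiv_eq, (h1.clm_comp h2).fderiv]
  simp [add_comm]

/-- Second derivative of `y ↦ L y (m y)`. -/
theorem d2_clm_apply {L : E → F →L[ℝ] G} {m : E → F} {x : E} (hL : ContDiffAt ℝ 2 L x)
    (hm : ContDiffAt ℝ 2 m x) (v w : E) :
    d2 (fun y => L y (m y)) x v w
      = d2 L x v w (m x) + fderiv ℝ L x w (fderiv ℝ m x v) + fderiv ℝ L x v (fderiv ℝ m x w)
        + L x (d2 m x v w) := by
  have hc : ContDiffAt ℝ 2 (fun y => L y (m y)) x := hL.clm_apply hm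
  have e : ∀ u, d2 (fun y => L y (m y)) x u w
      = fderiv ℝ (fun y => fderiv ℝ (fun y => L y (m y)) y w) x u := fun u => by
    rw [fderiv_clm_apply hc.twiceDiffAt.2 (differentiableAt_const w)]; simp [d2]
  have h : (fun y => fderiv ℝ (fun y => L y (m y)) y w)
      =ᶠ[𝓝 x] fun y => L y (fderiv ℝ m y w) + fderiv ℝ L y w (m y) := by
    filter_upwards [hL.twiceDiffAt.1, hm.twiceDiffAt.1] with y h1 h2
    rw [fderiv_clm_apply h1 h2]; simp
  have hm1 : DifferentiableAt ℝ m x := hm.differentiableAt (by simp)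
  have hL1 : DifferentiableAt ℝ L x := hL.differentiableAt (by simp)
  have hm2 := hm.twiceDiffAt.2
  have hL2 := hL.twiceDiffAt.2
  have hmw : DifferentiableAt ℝ (fun y => fderiv ℝ m y w) x :=
    hm2.clm_apply (differentiableAt_const w)
  have hLw : DifferentiableAt ℝ (fun y => fderiv ℝ L y w) x :=
    hL2.clm_apply (differentiableAt_const w)
  rw [e, h.fderiv_eq, fderiv_fun_add (hL1.clm_apply hmw) (hLw.clm_apply hm1),
    fderiv_clm_apply hL1 hmw, fderiv_clm_apply hLw hm1,
    fderiv_clm_apply hm2 (differentiableAt_const w),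
    fderiv_clm_apply hL2 (differentiableAt_const w)]
  simp only [d2, _root_.add_apply, ContinuousLinearMap.comp_apply,
    ContinuousLinearMap.flip_apply, fderiv_fun_const, Pi.zero_apply,
    _root_.zero_apply, map_zero, zero_add]
  abel

end TwiceDiff

section Integral

variable {n : ℕ} {G : Type*} [NormedAddCommGroup G] [NormedSpace ℝ G]
  {Z : Type*} [MeasurableSpace Z] {μ : Measure Z}

theorem aestronglyMeasurable_fderiv_param {F : (Fin n → ℝ) → Z → G} {x : Fin n → ℝ}
    (hF : ∀ᶠ y in 𝓝 x, AEStronglyMeasurable (F y) μ)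
    (hd : ∀ᵐ z ∂μ, DifferentiableAt ℝ (F · z) x) :
    AEStronglyMeasurable (fun z => fderiv ℝ (F · z) x) μ := by
  have key : ∀ v : Fin n → ℝ, AEStronglyMeasurable (fun z => fderiv ℝ (F · z) x v) μ := by
    intro v
    have ht : Tendsto (fun k : ℕ => x + (1 / ((k : ℝ) + 1)) • v) atTop (𝓝 x) := by
      have := (tendsto_one_div_add_atTop_nhds_zero_nat (𝕜 := ℝ)).smul_const v
      simpa using this.const_add x
    obtain ⟨N, hN⟩ := eventually_atTop.1 (ht.eventually hF)
    refine aestronglyMeasurable_of_tendsto_ae atTop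
      (f := fun k z => (((k + N : ℕ) : ℝ) + 1) •
        (F (x + (((k + N : ℕ) : ℝ) + 1)⁻¹ • v) z - F x z)) (fun k => ?_) ?_
    · have := hN (k + N) (by omega)
      rw [one_div] at this
      exact (this.sub hF.self_of_nhds).const_smul _
    · filter_upwards [hd] with z hz
      have h1 : Tendsto (fun k : ℕ => (((k + N : ℕ) : ℝ) + 1)) atTop atTop :=
        tendsto_atTop_add_const_right _ _
          (tendsto_natCast_atTop_atTop.comp (tendsto_add_atTop_nat N))
      exact hz.hasFDerivAt.lim v (tendsto_norm_atTop_atTop.comp h1)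
  have e : (fun z => fderiv ℝ (F · z) x) = fun z => ∑ i,
      (ContinuousLinearMap.proj (R := ℝ) (φ := fun _ : Fin n => ℝ) i).smulRight
        (fderiv ℝ (F · z) x (Pi.single i 1)) := by
    funext z
    ext v
    conv_lhs => rw [pi_eq_sum_univ' v]
    simp
  rw [e]
  refine Finset.aestronglyMeasurable_fun_sum _ fun i _ => ?_
  exact ((ContinuousLinearMap.smulRightL ℝ (Fin n → ℝ) G
    (ContinuousLinearMap.proj i)).continuous.comp_aestronglyMeasurable (key _))

theorem hasFDerivAt_integral_of_bounded [IsFiniteMeasure μ] [CompleteSpace G]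
    {F : (Fin n → ℝ) → Z → G} {x : Fin n → ℝ} {r C : ℝ}
    (hF : ∀ y ∈ ball x r, AEStronglyMeasurable (F y) μ)
    (hb : ∀ᵐ z ∂μ, ∀ y ∈ ball x r, ‖F y z‖ ≤ C)
    (hd : ∀ᵐ z ∂μ, ∀ y ∈ ball x r, DifferentiableAt ℝ (F · z) y)
    (hdb : ∀ᵐ z ∂μ, ∀ y ∈ ball x r, ‖fderiv ℝ (F · z) y‖ ≤ C) {y : Fin n → ℝ}
    (hy : y ∈ ball x r) :
    HasFDerivAt (fun y => ∫ z, F y z ∂μ) (∫ z, fderiv ℝ (F · z) y ∂μ) y := by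
  have hn : ball x r ∈ 𝓝 y := isOpen_ball.mem_nhds hy
  have hFe : ∀ᶠ y' in 𝓝 y, AEStronglyMeasurable (F y') μ := by
    filter_upwards [hn] with y' hy' using hF y' hy'
  refine hasFDerivAt_integral_of_dominated_of_fderiv_le (F' := fun y z => fderiv ℝ (F · z) y)
    (bound := fun _ => C) hn hFe
    (Integrable.of_bound (hF y hy) C (hb.mono fun z hz => hz y hy))
    (aestronglyMeasurable_fderiv_param hFe (hd.mono fun z hz => hz y hy)) hdb
    (integrable_const C) (hd.mono fun z hz y' hy' => (hz y' hy').hasFDerivAt)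

set_option maxSynthPendingDepth 3 in
/-- Differentiating twice under the integral sign. -/
theorem twiceDiffAt_integral_of_bounded [IsFiniteMeasure μ] [CompleteSpace G]
    {F : (Fin n → ℝ) → Z → G} {x : Fin n → ℝ} {r C : ℝ} (hr : 0 < r)
    (hF : ∀ y ∈ ball x r, AEStronglyMeasurable (F y) μ)
    (hb : ∀ᵐ z ∂μ, ∀ y ∈ ball x r, ‖F y z‖ ≤ C)
    (hd : ∀ᵐ z ∂μ, ∀ y ∈ ball x r, ContDiffAt ℝ 2 (F · z) y)
    (hdb : ∀ᵐ z ∂μ, ∀ y ∈ ball x r, ‖fderiv ℝ (F · z) y‖ ≤ C)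
    (hdb2 : ∀ᵐ z ∂μ, ∀ y ∈ ball x r, ‖d2 (F · z) y‖ ≤ C) :
    TwiceDiffAt (fun y => ∫ z, F y z ∂μ) x ∧
      (∀ v w, d2 (fun y => ∫ z, F y z ∂μ) x v w = ∫ z, d2 (F · z) x v w ∂μ) ∧
      ∀ v w, AEStronglyMeasurable (fun z => d2 (F · z) x v w) μ := by
  have hd1 : ∀ᵐ z ∂μ, ∀ y ∈ ball x r, DifferentiableAt ℝ (F · z) y :=
    hd.mono fun z hz y hy => (hz y hy).differentiableAt (by simp)
  have hd2 : ∀ᵐ z ∂μ, ∀ y ∈ ball x r, DifferentiableAt ℝ (fun y => fderiv ℝ (F · z) y) y :=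
    hd.mono fun z hz y hy => (hz y hy).twiceDiffAt.2
  have h1 : ∀ y ∈ ball x r, HasFDerivAt (fun y => ∫ z, F y z ∂μ)
      (∫ z, fderiv ℝ (F · z) y ∂μ) y := fun y hy =>
    hasFDerivAt_integral_of_bounded hF hb hd1 hdb hy
  have hn : ∀ y ∈ ball x r, ball x r ∈ 𝓝 y := fun y hy => isOpen_ball.mem_nhds hy
  have hm : ∀ y ∈ ball x r, AEStronglyMeasurable (fun z => fderiv ℝ (F · z) y) μ := by
    intro y hy
    refine aestronglyMeasurable_fderiv_param ?_ (hd1.mono fun z hz => hz y hy)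
    filter_upwards [hn y hy] with y' hy' using hF y' hy'
  have hx := mem_ball_self (x := x) hr
  have h2 := hasFDerivAt_integral_of_bounded (F := fun y z => fderiv ℝ (F · z) y) hm hdb hd2
    hdb2 hx
  have hm2 : AEStronglyMeasurable (fun z => d2 (F · z) x) μ := by
    refine aestronglyMeasurable_fderiv_param (F := fun y z => fderiv ℝ (F · z) y) ?_
      (hd2.mono fun z hz => hz x hx)
    filter_upwards [hn x hx] with y' hy' using hm y' hy'
  have he : fderiv ℝ (fun y => ∫ z, F y z ∂μ) =ᶠ[𝓝 x] fun y => ∫ z, fderiv ℝ (F · z) y ∂μ := by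
    filter_upwards [hn x hx] with y hy using (h1 y hy).fderiv
  have hInt : Integrable (fun z => d2 (F · z) x) μ :=
    Integrable.of_bound hm2 C (hdb2.mono fun z hz => hz x hx)
  refine ⟨⟨?_, (h2.congr_of_eventuallyEq he).differentiableAt⟩, fun v w => ?_, fun v w => ?_⟩
  · filter_upwards [hn x hx] with y hy using (h1 y hy).differentiableAt
  · rw [d2, (h2.congr_of_eventuallyEq he).fderiv]
    have e1 := ContinuousLinearMap.integral_apply hInt v
    have e2 := ContinuousLinearMap.integral_apply (hInt.apply_continuousLinearMap v) w
    rw [← e2, ← e1]; rfl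
  · exact ((hm2.apply_continuousLinearMap v).apply_continuousLinearMap w)

end Integral

section JetBound

variable {E F : Type*} [NormedAddCommGroup E] [NormedSpace ℝ E] [NormedAddCommGroup F]
    [NormedSpace ℝ F]

theorem opNorm_le_div_of_bound_on_closedBall {L : E →L[ℝ] F} {s c : ℝ} (hs : 0 < s)
    (hc : 0 ≤ c) (h : ∀ w, ‖w‖ ≤ s → ‖L w‖ ≤ c) : ‖L‖ ≤ c / s := by
  refine L.opNorm_le_bound (by positivity) fun w => ?_
  rcases eq_or_ne w 0 with rfl | hw
  · simp
  have hw' : 0 < ‖w‖ := norm_pos_iff.2 hw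
  have h1 := h ((s / ‖w‖) • w) (by
    rw [norm_smul, Real.norm_of_nonneg (by positivity), div_mul_cancel₀ _ hw'.ne'])
  rw [map_smul, norm_smul, Real.norm_of_nonneg (by positivity)] at h1
  rw [div_mul_eq_mul_div, le_div_iff₀ hs]
  rw [div_mul_eq_mul_div, div_le_iff₀ hw'] at h1
  linarith

set_option maxSynthPendingDepth 3 in
/-- A bound on a function and on the oscillation of its second derivative bounds the first
two derivatives. -/
theorem exists_bound_fderiv_d2 {r : ℝ} (hr : 0 < r) {B C : ℝ} (hB : 0 ≤ B) (hC : 0 ≤ C) :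
    ∃ K : ℝ, ∀ (φ : E → F) (x : E), (∀ y ∈ ball x (2 * r), ContDiffAt ℝ 2 φ y) →
      (∀ y ∈ ball x (2 * r), ‖φ y‖ ≤ B) →
      (∀ y ∈ ball x (2 * r), ∀ y' ∈ ball x (2 * r), ‖d2 φ y - d2 φ y'‖ ≤ C) →
      ∀ y ∈ ball x r, ‖fderiv ℝ φ y‖ ≤ K ∧ ‖d2 φ y‖ ≤ K := by
  set s := r / 2 with hs
  have hs0 : 0 < s := by positivity
  set c := 4 * B + C * s * s with hc
  have hc0 : 0 ≤ c := by positivity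
  set K2 := c / s / s + C with hK2
  have hK20 : 0 ≤ K2 := by positivity
  set K1 := (2 * B + K2 * (4 * r) * s) / s with hK1
  have hK10 : 0 ≤ K1 := by positivity
  refine ⟨K1 + K2, fun φ x hφ hφB hφC => ?_⟩
  have hdiff : ∀ y ∈ ball x (2 * r), DifferentiableAt ℝ φ y := fun y hy =>
    (hφ y hy).differentiableAt (by simp)
  have hdiff2 : ∀ y ∈ ball x (2 * r), DifferentiableAt ℝ (fderiv ℝ φ) y := fun y hy =>
    (hφ y hy).twiceDiffAt.2
  have hmem : ∀ y ∈ ball x r, ∀ w u : E, ‖w‖ ≤ s → ‖u‖ ≤ s → y + w + u ∈ ball x (2 * r) := by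
    intro y hy w u hw hu
    rw [mem_ball_iff_norm] at hy ⊢
    calc ‖y + w + u - x‖ = ‖(y - x) + w + u‖ := by congr 1; abel
      _ ≤ ‖y - x‖ + ‖w‖ + ‖u‖ := norm_add₃_le
      _ < 2 * r := by linarith
  have hsub : ball x r ⊆ ball x (2 * r) := ball_subset_ball (by linarith)
  have hd2 : ∀ y ∈ ball x r, ‖d2 φ y‖ ≤ c / s / s := by
    intro y hy
    refine opNorm_le_div_of_bound_on_closedBall hs0 (by positivity) fun w hw => ?_
    refine opNorm_le_div_of_bound_on_closedBall hs0 hc0 fun u hu => ?_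
    have h1 : ∀ y' ∈ closedBall y s, y' ∈ ball x (2 * r) ∧ y' + w ∈ ball x (2 * r) := by
      intro y' hy'
      rw [mem_closedBall_iff_norm] at hy'
      have ha := hmem y hy (y' - y) 0 hy' (by simpa using hs0.le)
      have hb := hmem y hy (y' - y) w hy' hw
      simp only [add_sub_cancel, add_zero] at ha hb
      exact ⟨ha, hb⟩
    have h2 : ∀ y' ∈ closedBall y s,
        ‖fderiv ℝ φ (y' + w) - fderiv ℝ φ y' - d2 φ y w‖ ≤ C * ‖w‖ := by
      intro y' hy'
      have := (convex_ball x (2 * r)).norm_image_sub_le_of_norm_fderiv_le' (𝕜 := ℝ)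
        (f := fderiv ℝ φ) (φ := d2 φ y) (C := C) hdiff2
        (fun p hp => hφC p hp y (hsub hy)) (h1 y' hy').1 (h1 y' hy').2
      simpa using this
    have hR : ∀ y' ∈ closedBall y s, HasFDerivAt (fun p => φ (p + w) - φ p)
        (fderiv ℝ φ (y' + w) - fderiv ℝ φ y') y' := by
      intro y' hy'
      have ha := (hasFDerivAt_comp_add_right w).2 (hdiff _ (h1 y' hy').2).hasFDerivAt
      exact ha.sub (hdiff _ (h1 y' hy').1).hasFDerivAt
    have h3 := (convex_closedBall y s).norm_image_sub_le_of_norm_hasFDerivWithin_le' (𝕜 := ℝ)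
        (f := fun p => φ (p + w) - φ p) (φ := d2 φ y w) (C := C * ‖w‖)
        (fun p hp => (hR p hp).hasFDerivWithinAt) h2 (mem_closedBall_self hs0.le)
        (y := y + u) (by simpa using hu)
    simp only [add_sub_cancel_left] at h3
    have b1 := hφB _ (h1 (y + u) (by simpa using hu)).2
    have b2 := hφB _ (h1 (y + u) (by simpa using hu)).1
    have b3 := hφB _ (h1 y (mem_closedBall_self hs0.le)).2
    have b4 := hφB _ (h1 y (mem_closedBall_self hs0.le)).1
    have e : d2 φ y w u = (φ (y + u + w) - φ (y + u)) - (φ (y + w) - φ y)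
        - (φ (y + u + w) - φ (y + u) - (φ (y + w) - φ y) - d2 φ y w u) := by abel
    have h4 : C * ‖w‖ * ‖u‖ ≤ C * s * s := by gcongr
    rw [e]
    have t1 := norm_sub_le (φ (y + u + w) - φ (y + u)) (φ (y + w) - φ y)
    have t2 := norm_sub_le (φ (y + u + w)) (φ (y + u))
    have t3 := norm_sub_le (φ (y + w)) (φ y)
    refine (norm_sub_le _ _).trans ?_
    linarith
  have hx : x ∈ ball x r := mem_ball_self hr
  have hd2' : ∀ y ∈ ball x (2 * r), ‖d2 φ y‖ ≤ K2 := by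
    intro y hy
    have h1 := hφC y hy x (hsub hx)
    have h2 := hd2 x hx
    calc ‖d2 φ y‖ = ‖(d2 φ y - d2 φ x) + d2 φ x‖ := by simp
      _ ≤ ‖d2 φ y - d2 φ x‖ + ‖d2 φ x‖ := norm_add_le _ _
      _ ≤ K2 := by linarith
  have hosc : ∀ y ∈ ball x (2 * r), ∀ y' ∈ ball x (2 * r),
      ‖fderiv ℝ φ y' - fderiv ℝ φ y‖ ≤ K2 * (4 * r) := by
    intro y hy y' hy'
    refine ((convex_ball x (2 * r)).norm_image_sub_le_of_norm_fderiv_le (𝕜 := ℝ)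
      hdiff2 hd2' hy hy').trans ?_
    gcongr
    have := dist_triangle_right y' y x
    rw [mem_ball] at hy hy'
    rw [← dist_eq_norm]
    linarith
  intro y hy
  have hd1 : ‖fderiv ℝ φ y‖ ≤ K1 := by
    refine opNorm_le_div_of_bound_on_closedBall hs0 (by positivity) fun u hu => ?_
    have hy2 : y + u ∈ ball x (2 * r) := by
      simpa using hmem y hy u 0 hu (by simpa using hs0.le)
    have h3 := (convex_ball x (2 * r)).norm_image_sub_le_of_norm_fderiv_le' (𝕜 := ℝ)
        (f := φ) (φ := fderiv ℝ φ y) hdiff (fun p hp => hosc y (hsub hy) p hp) (hsub hy) hy2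
    simp only [add_sub_cancel_left] at h3
    have b1 := hφB _ hy2
    have b2 := hφB _ (hsub hy)
    have e : fderiv ℝ φ y u = φ (y + u) - φ y - (φ (y + u) - φ y - fderiv ℝ φ y u) := by abel
    have h4 : K2 * (4 * r) * ‖u‖ ≤ K2 * (4 * r) * s := by gcongr
    rw [e]
    have t1 := norm_sub_le (φ (y + u)) (φ y)
    refine (norm_sub_le _ _).trans ?_
    linarith
  exact ⟨by linarith, by have := hd2' y (hsub hy); linarith⟩

end JetBound

theorem isOpen_posOrth (n : ℕ) : IsOpen (posOrth n) := by
  have : posOrth n = ⋂ i, {x | 0 < x i} := by ext; simp [posOrth]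
  rw [this]
  exact isOpen_iInter_of_finite fun i => isOpen_lt continuous_const (continuous_apply i)

theorem convex_posOrth (n : ℕ) : Convex ℝ (posOrth n) := by
  intro x hx y hy a b ha hb hab i
  have h1 := hx i
  have h2 := hy i
  simp only [Pi.add_apply, Pi.smul_apply, smul_eq_mul]
  rcases ha.eq_or_lt with rfl | ha'
  · have : b = 1 := by linarith
    simpa [this] using h2
  · have := mul_pos ha' h1
    have := mul_nonneg hb h2.le
    linarith

theorem Icc_subset_posOrth {n : ℕ} {a b : Fin n → ℝ} (ha : a ∈ posOrth n) :
    Icc a b ⊆ posOrth n := fun _ hy i => (ha i).trans_le (hy.1 i)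

/-- Near `x`, the jump map `ψ(·,z)` has uniformly bounded two-jets, and jumps from
points near `x` stay in the compact box `[a,b]` of the open orthant. -/
structure JumpJet {n : ℕ} (ψ : (Fin n → ℝ) → ℝ → Fin n → ℝ) (x : Fin n → ℝ) (r P : ℝ)
    (a b : Fin n → ℝ) : Prop where
  r_pos : 0 < r
  a_pos : a ∈ posOrth n
  meas : ∀ y ∈ ball x r, Measurable (ψ y)
  smooth : ∀ z ∈ Icc (0:ℝ) 1, ∀ y ∈ ball x r, ContDiffAt ℝ 2 (fun y => ψ y z) y
  norm_le : ∀ z ∈ Icc (0:ℝ) 1, ∀ y ∈ ball x r, ‖ψ y z‖ ≤ P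
  norm_fderiv_le : ∀ z ∈ Icc (0:ℝ) 1, ∀ y ∈ ball x r, ‖fderiv ℝ (fun y => ψ y z) y‖ ≤ P
  norm_d2_le : ∀ z ∈ Icc (0:ℝ) 1, ∀ y ∈ ball x r, ‖d2 (fun y => ψ y z) y‖ ≤ P
  mem_box : ∀ y ∈ ball x r, y ∈ Icc a b
  jump_mem_box : ∀ z ∈ Icc (0:ℝ) 1, ∀ y ∈ ball x r, y + ψ y z ∈ Icc a b

theorem norm_d2_sub_le_iteratedFDeriv {E F : Type*} [NormedAddCommGroup E] [NormedSpace ℝ E]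
    [NormedAddCommGroup F] [NormedSpace ℝ F] (f : E → F) (x y : E) :
    ‖d2 f x - d2 f y‖ ≤ ‖iteratedFDeriv ℝ 2 f x - iteratedFDeriv ℝ 2 f y‖ := by
  refine ContinuousLinearMap.opNorm_le_bound₂ _ (norm_nonneg _) fun v w => ?_
  have h := (iteratedFDeriv ℝ 2 f x - iteratedFDeriv ℝ 2 f y).le_opNorm ![v, w]
  simp only [_root_.sub_apply, iteratedFDeriv_two_apply,
    Fin.prod_univ_two] at h
  simpa [d2, mul_assoc] using h

theorem JumpKernel.exists_jumpJet {n : ℕ} {T : ℝ} (K : JumpKernel n T) {x : Fin n → ℝ}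
    (hx : x ∈ posOrth n) {t : ℝ} (ht : t ∈ Icc (0:ℝ) T) :
    ∃ (r P : ℝ) (a b : Fin n → ℝ), JumpJet (fun y z => K.φ y t z) x r P a b := by
  obtain ⟨α, hα0, -, hα⟩ := K.holder2
  obtain ⟨s, hs, hsO, C, hC⟩ := hα t ht x hx
  obtain ⟨D, hD0, hD⟩ := K.bound
  obtain ⟨γ, hγ, hlow⟩ := K.lower
  have hbox : {y : Fin n → ℝ | ∀ i, x i / 2 < y i ∧ y i < 2 * x i} ∈ 𝓝 x := by
    have : {y : Fin n → ℝ | ∀ i, x i / 2 < y i ∧ y i < 2 * x i}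
        = ⋂ i, {y | x i / 2 < y i} ∩ {y | y i < 2 * x i} := by
      ext; simp
    rw [this]
    refine (isOpen_iInter_of_finite fun i =>
      (isOpen_lt continuous_const (continuous_apply i)).inter
        (isOpen_lt (continuous_apply i) continuous_const)).mem_nhds ?_
    simp only [mem_iInter, mem_inter_iff, mem_ofPred_eq]
    intro i
    have := hx i
    constructor <;> linarith
  obtain ⟨R, hR0, hR⟩ := Metric.mem_nhds_iff.1 (inter_mem hs hbox)
  obtain ⟨r, hr0, rfl⟩ : ∃ r, 0 < r ∧ 2 * r = R := ⟨R / 2, by positivity, by ring⟩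
  have hO : ∀ y ∈ ball x (2 * r), y ∈ posOrth n := fun y hy => hsO (hR hy).1
  set B := √D * (2 * ‖x‖) with hB
  have hB0 : 0 ≤ B := by positivity
  have hφB : ∀ z ∈ Icc (0:ℝ) 1, ∀ y ∈ ball x (2 * r), ∀ i, |K.φ y t z i| ≤ √D * (2 * x i) := by
    intro z hz y hy i
    have h1 := hD y (hO y hy) t ht z hz i
    have h2 := (hR hy).2 i
    have h3 := hO y hy i
    have h4 : |K.φ y t z i| ≤ √D * y i := by
      refine abs_le_of_sq_le_sq ?_ (by positivity)
      rwa [mul_pow, Real.sq_sqrt hD0.le]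
    exact h4.trans (by gcongr; exact h2.2.le)
  have hφN : ∀ z ∈ Icc (0:ℝ) 1, ∀ y ∈ ball x (2 * r), ‖K.φ y t z‖ ≤ B := by
    intro z hz y hy
    rw [pi_norm_le_iff_of_nonneg hB0]
    intro i
    refine (hφB z hz y hy i).trans ?_
    rw [hB]
    gcongr
    exact (le_abs_self _).trans (norm_le_pi_norm x i)
  set C' := (C : ℝ) * (4 * r) ^ (α : ℝ) with hC'
  have hC'0 : 0 ≤ C' := by positivity
  have hosc : ∀ z ∈ Icc (0:ℝ) 1, ∀ y ∈ ball x (2 * r), ∀ y' ∈ ball x (2 * r),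
      ‖d2 (fun y => K.φ y t z) y - d2 (fun y => K.φ y t z) y'‖ ≤ C' := by
    intro z hz y hy y' hy'
    refine (norm_d2_sub_le_iteratedFDeriv _ _ _).trans ?_
    have h := (hC z hz).dist_le (hR hy).1 (hR hy').1
    rw [dist_eq_norm] at h
    refine h.trans ?_
    rw [hC']
    gcongr
    have := dist_triangle_right y y' x
    rw [mem_ball] at hy hy'
    linarith
  have hsm : ∀ z ∈ Icc (0:ℝ) 1, ∀ y ∈ ball x (2 * r), ContDiffAt ℝ 2 (fun y => K.φ y t z) y :=
    fun z hz y hy => (K.smooth t ht z hz).contDiffAt ((isOpen_posOrth n).mem_nhds (hO y hy))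
  obtain ⟨K2, hK2⟩ := exists_bound_fderiv_d2 (E := Fin n → ℝ) (F := Fin n → ℝ) hr0 hB0 hC'0
  have hsub : ball x r ⊆ ball x (2 * r) := ball_subset_ball (by linarith)
  have hγ' : 0 < 1 + γ := by linarith
  set δ := min 1 (1 + γ) with hδ
  have hδ0 : 0 < δ := lt_min one_pos hγ'
  refine ⟨r, max B K2, fun i => δ * (x i / 2), fun i => (1 + √D) * (2 * x i), hr0,
    fun i => mul_pos hδ0 (by have := hx i; linarith),
    fun y hy => K.meas y (hO y (hsub hy)) t ht, fun z hz y hy => hsm z hz y (hsub hy),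
    fun z hz y hy => (hφN z hz y (hsub hy)).trans (le_max_left _ _),
    fun z hz y hy => ((hK2 _ x (hsm z hz) (hφN z hz) (hosc z hz) y hy).1).trans (le_max_right _ _),
    fun z hz y hy => ((hK2 _ x (hsm z hz) (hφN z hz) (hosc z hz) y hy).2).trans (le_max_right _ _),
    fun y hy => ⟨fun i => ?_, fun i => ?_⟩, fun z hz y hy => ⟨fun i => ?_, fun i => ?_⟩⟩
  · have h2 := (hR (hsub hy)).2 i
    have h3 := hx i
    have : δ * (x i / 2) ≤ 1 * (x i / 2) := by gcongr; exact min_le_left _ _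
    linarith
  · have h2 := (hR (hsub hy)).2 i
    have h3 := hx i
    have : 0 ≤ √D * (2 * x i) := by positivity
    linarith
  · have h2 := (hR (hsub hy)).2 i
    have h3 := hx i
    have h4 := hlow y (hO y (hsub hy)) t ht z hz i
    have : δ * (x i / 2) ≤ (1 + γ) * y i := by
      gcongr
      · exact min_le_right _ _
      · exact h2.1.le
    simp only [Pi.add_apply]
    linarith
  · have h2 := (hR (hsub hy)).2 i
    have h4 := (abs_le.1 (hφB z hz y (hsub hy) i)).2
    simp only [Pi.add_apply]
    linarith

theorem ContinuousOn.aestronglyMeasurable_comp_of_mem_posOrth {n : ℕ} {g : (Fin n → ℝ) → ℝ}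
    (hg : ContinuousOn g (posOrth n)) {p : ℝ → Fin n → ℝ} (hp : Measurable p)
    (hmem : ∀ z ∈ Icc (0:ℝ) 1, p z ∈ posOrth n) :
    AEStronglyMeasurable (fun z => g (p z)) (volume.restrict (Icc (0:ℝ) 1)) := by
  classical
  have h1 : Measurable ((posOrth n).piecewise g 0) :=
    hg.measurable_piecewise continuousOn_const (isOpen_posOrth n).measurableSet
  refine (h1.comp hp).aestronglyMeasurable.congr ?_
  refine (ae_restrict_iff' measurableSet_Icc).2 (Eventually.of_forall fun z hz => ?_)
  exact Set.piecewise_eq_of_mem _ _ _ (hmem z hz)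

section Jump

variable {n : ℕ} {ψ : (Fin n → ℝ) → ℝ → Fin n → ℝ} {x : Fin n → ℝ} {r P : ℝ}
  {a b : Fin n → ℝ} {g : (Fin n → ℝ) → ℝ}

theorem JumpJet.mem_posOrth (h : JumpJet ψ x r P a b) {y : Fin n → ℝ} (hy : y ∈ ball x r) :
    y ∈ posOrth n := Icc_subset_posOrth h.a_pos (h.mem_box y hy)

theorem JumpJet.jump_mem_posOrth (h : JumpJet ψ x r P a b) {z : ℝ} (hz : z ∈ Icc (0:ℝ) 1)
    {y : Fin n → ℝ} (hy : y ∈ ball x r) :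
    y + ψ y z ∈ posOrth n := Icc_subset_posOrth h.a_pos (h.jump_mem_box z hz y hy)

theorem JumpJet.P_nonneg (h : JumpJet ψ x r P a b) : 0 ≤ P :=
  (norm_nonneg _).trans (h.norm_le 0 (by simp) x (mem_ball_self h.r_pos))

theorem contDiffAt_of_posOrth {k : WithTop ℕ∞} {F : Type*} [NormedAddCommGroup F]
    [NormedSpace ℝ F] {g : (Fin n → ℝ) → F} (hg : ContDiffOn ℝ k g (posOrth n))
    {y : Fin n → ℝ} (hy : y ∈ posOrth n) : ContDiffAt ℝ k g y :=
  hg.contDiffAt ((isOpen_posOrth n).mem_nhds hy)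

set_option maxSynthPendingDepth 3 in
theorem exists_jet_bound (hg : ContDiffOn ℝ 4 g (posOrth n)) (ha : a ∈ posOrth n) :
    ∃ G : ℝ, 0 ≤ G ∧ ∀ y ∈ Icc a b, ‖g y‖ ≤ G ∧ ‖fderiv ℝ g y‖ ≤ G ∧ ‖d2 g y‖ ≤ G ∧
      ‖d2 (fderiv ℝ g) y‖ ≤ G := by
  have hsub := Icc_subset_posOrth (b := b) ha
  have c0 : ContinuousOn g (Icc a b) := hg.continuousOn.mono hsub
  have c1 : ContinuousOn (fderiv ℝ g) (Icc a b) := fun y hy =>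
    ((contDiffAt_of_posOrth hg (hsub hy)).fderiv_right (m := 3)
      (by norm_num)).continuousAt.continuousWithinAt
  have c2 : ContinuousOn (d2 g) (Icc a b) := fun y hy =>
    (((contDiffAt_of_posOrth hg (hsub hy)).fderiv_right (m := 3)
      (by norm_num)).fderiv_right (m := 2) (by norm_num)).continuousAt.continuousWithinAt
  have c3 : ContinuousOn (d2 (fderiv ℝ g)) (Icc a b) := fun y hy =>
    ((((contDiffAt_of_posOrth hg (hsub hy)).fderiv_right (m := 3)
      (by norm_num)).fderiv_right (m := 2) (by norm_num)).fderiv_right (m := 1)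
        (by norm_num)).continuousAt.continuousWithinAt
  obtain ⟨G0, h0⟩ := isCompact_Icc.exists_bound_of_continuousOn c0
  obtain ⟨G1, h1⟩ := isCompact_Icc.exists_bound_of_continuousOn c1
  obtain ⟨G2, h2⟩ := isCompact_Icc.exists_bound_of_continuousOn c2
  obtain ⟨G3, h3⟩ := isCompact_Icc.exists_bound_of_continuousOn c3
  refine ⟨|G0| + |G1| + |G2| + |G3|, by positivity, fun y hy => ?_⟩
  have := le_abs_self G0
  have := le_abs_self G1
  have := le_abs_self G2
  have := le_abs_self G3
  have := abs_nonneg G0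
  have := abs_nonneg G1
  have := abs_nonneg G2
  have := abs_nonneg G3
  exact ⟨(h0 y hy).trans (by linarith), (h1 y hy).trans (by linarith),
    (h2 y hy).trans (by linarith), (h3 y hy).trans (by linarith)⟩

/-- The second derivative at `x` in direction `v` of the compensated jump of `g`, once the
terms vanishing at a degenerate direction are removed. -/
def jumpForm (ψ : (Fin n → ℝ) → ℝ → Fin n → ℝ) (g : (Fin n → ℝ) → ℝ) (x v : Fin n → ℝ) (z : ℝ) :
    ℝ :=
  d2 g (x + ψ x z) (v + fderiv ℝ (fun y => ψ y z) x v) (v + fderiv ℝ (fun y => ψ y z) x v)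
    + fderiv ℝ g (x + ψ x z) (d2 (fun y => ψ y z) x v v)
    - fderiv ℝ g x (d2 (fun y => ψ y z) x v v)

theorem JumpJet.contDiffAt_comp (h : JumpJet ψ x r P a b) (hg : ContDiffOn ℝ 4 g (posOrth n))
    {z : ℝ} (hz : z ∈ Icc (0:ℝ) 1) {y : Fin n → ℝ} (hy : y ∈ ball x r) :
    ContDiffAt ℝ 2 (fun y => g (y + ψ y z)) y :=
  ((contDiffAt_of_posOrth hg (h.jump_mem_posOrth hz hy)).of_le (by norm_num)).comp y
    (contDiffAt_id.add (h.smooth z hz y hy))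

theorem fderiv_id_add {φ : (Fin n → ℝ) → Fin n → ℝ} {y : Fin n → ℝ}
    (h : ContDiffAt ℝ 2 φ y) (v : Fin n → ℝ) :
    fderiv ℝ (fun y => y + φ y) y v = v + fderiv ℝ φ y v := by
  rw [fderiv_fun_add differentiableAt_fun_id (h.differentiableAt (by simp))]
  simp

theorem d2_id (y : Fin n → ℝ) : d2 (fun y : Fin n → ℝ => y) y = 0 := by
  have : fderiv ℝ (fun y : Fin n → ℝ => y) = fun _ => ContinuousLinearMap.id ℝ _ := by
    funext y; exact fderiv_fun_id
  rw [d2, this]; simp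

theorem d2_id_add {φ : (Fin n → ℝ) → Fin n → ℝ} {y : Fin n → ℝ}
    (h : ContDiffAt ℝ 2 φ y) :
    d2 (fun y => y + φ y) y = d2 φ y := by
  rw [d2_add contDiffAt_fun_id.twiceDiffAt h.twiceDiffAt, d2_id, zero_add]

theorem JumpJet.d2_integrand (h : JumpJet ψ x r P a b) (hg : ContDiffOn ℝ 4 g (posOrth n))
    {z : ℝ} (hz : z ∈ Icc (0:ℝ) 1) {y : Fin n → ℝ} (hy : y ∈ ball x r) (v w : Fin n → ℝ) :
    d2 (fun y => g (y + ψ y z) - g y - fderiv ℝ g y (ψ y z)) y v w =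
      d2 g (y + ψ y z) (v + fderiv ℝ (fun y => ψ y z) y v) (w + fderiv ℝ (fun y => ψ y z) y w)
        + fderiv ℝ g (y + ψ y z) (d2 (fun y => ψ y z) y v w) - d2 g y v w
        - (d2 (fderiv ℝ g) y v w (ψ y z) + d2 g y w (fderiv ℝ (fun y => ψ y z) y v)
          + d2 g y v (fderiv ℝ (fun y => ψ y z) y w)
          + fderiv ℝ g y (d2 (fun y => ψ y z) y v w)) := by
  have hψ := h.smooth z hz y hy
  have hgy := contDiffAt_of_posOrth hg (h.mem_posOrth hy)
  have hgj := contDiffAt_of_posOrth hg (h.jump_mem_posOrth hz hy)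
  have hD : ContDiffAt ℝ 2 (fderiv ℝ g) y := hgy.fderiv_right (by norm_num)
  have t1 := (h.contDiffAt_comp hg hz hy)
  have t2 : ContDiffAt ℝ 2 g y := hgy.of_le (by norm_num)
  have t3 : ContDiffAt ℝ 2 (fun y => fderiv ℝ g y (ψ y z)) y := hD.clm_apply hψ
  rw [d2_sub (t1.sub t2).twiceDiffAt t3.twiceDiffAt, d2_sub t1.twiceDiffAt t2.twiceDiffAt]
  simp only [_root_.sub_apply]
  rw [d2_clm_apply hD hψ, d2_comp (g := g) (m := fun y => y + ψ y z)
    (hgj.of_le (by norm_num)) (contDiffAt_id.add hψ), fderiv_id_add hψ, fderiv_id_add hψ,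
    d2_id_add hψ]
  rfl

theorem JumpJet.fderiv_integrand (h : JumpJet ψ x r P a b) (hg : ContDiffOn ℝ 4 g (posOrth n))
    {z : ℝ} (hz : z ∈ Icc (0:ℝ) 1) {y : Fin n → ℝ} (hy : y ∈ ball x r) (v : Fin n → ℝ) :
    fderiv ℝ (fun y => g (y + ψ y z) - g y - fderiv ℝ g y (ψ y z)) y v =
      fderiv ℝ g (y + ψ y z) (v + fderiv ℝ (fun y => ψ y z) y v) - fderiv ℝ g y v
        - (fderiv ℝ g y (fderiv ℝ (fun y => ψ y z) y v) + d2 g y v (ψ y z)) := by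
  have hψ := h.smooth z hz y hy
  have hgy := contDiffAt_of_posOrth hg (h.mem_posOrth hy)
  have hgj := contDiffAt_of_posOrth hg (h.jump_mem_posOrth hz hy)
  have hD : ContDiffAt ℝ 2 (fderiv ℝ g) y := hgy.fderiv_right (by norm_num)
  have hψ1 : DifferentiableAt ℝ (fun y => ψ y z) y := hψ.differentiableAt (by simp)
  have hD1 : DifferentiableAt ℝ (fderiv ℝ g) y := hD.differentiableAt (by simp)
  have t1 : DifferentiableAt ℝ (fun y => g (y + ψ y z)) y :=
    (h.contDiffAt_comp hg hz hy).differentiableAt (by simp)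
  have t2 : DifferentiableAt ℝ g y := hgy.differentiableAt (by simp)
  have t3 : DifferentiableAt ℝ g (y + ψ y z) := hgj.differentiableAt (by simp)
  have t4 : DifferentiableAt ℝ (fun y => y + ψ y z) y := differentiableAt_fun_id.add hψ1
  rw [fderiv_fun_sub (t1.fun_sub t2) (hD1.clm_apply hψ1), fderiv_fun_sub t1 t2,
    fderiv_clm_apply hD1 hψ1]
  have : fderiv ℝ (fun y => g (y + ψ y z)) y
      = (fderiv ℝ g (y + ψ y z)).comp (fderiv ℝ (fun y => y + ψ y z) y) :=
    fderiv_comp y t3 t4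
  rw [this]
  simp [fderiv_id_add hψ, d2]

set_option maxSynthPendingDepth 3 in
theorem JumpJet.twiceDiffAt_integral (h : JumpJet ψ x r P a b)
    (hg : ContDiffOn ℝ 4 g (posOrth n)) :
    TwiceDiffAt (fun y => ∫ z in Icc (0:ℝ) 1, (g (y + ψ y z) - g y - fderiv ℝ g y (ψ y z))) x ∧
    (∀ v w, d2 (fun y => ∫ z in Icc (0:ℝ) 1, (g (y + ψ y z) - g y - fderiv ℝ g y (ψ y z))) x v w
      = ∫ z in Icc (0:ℝ) 1, d2 (fun y => g (y + ψ y z) - g y - fderiv ℝ g y (ψ y z)) x v w) ∧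
    ∀ v w, AEStronglyMeasurable
      (fun z => d2 (fun y => g (y + ψ y z) - g y - fderiv ℝ g y (ψ y z)) x v w)
      (volume.restrict (Icc (0:ℝ) 1)) := by
  obtain ⟨G, hG0, hG⟩ := exists_jet_bound (b := b) hg h.a_pos
  have hP := h.P_nonneg
  have hae : ∀ {p : ℝ → Prop}, (∀ z ∈ Icc (0:ℝ) 1, p z) →
      ∀ᵐ z ∂(volume.restrict (Icc (0:ℝ) 1)), p z := fun {p} hp =>
    (ae_restrict_iff' measurableSet_Icc).2 (Eventually.of_forall hp)
  refine twiceDiffAt_integral_of_bounded (μ := volume.restrict (Icc (0:ℝ) 1))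
    (F := fun y z => g (y + ψ y z) - g y - fderiv ℝ g y (ψ y z)) (r := r)
    (C := G * (2 + 7 * P + P ^ 2)) h.r_pos (fun y hy => ?_) (hae fun z hz y hy => ?_)
    (hae fun z hz y hy => ?_) (hae fun z hz y hy => ?_) (hae fun z hz y hy => ?_)
  · have h1 : AEStronglyMeasurable (fun z => g (y + ψ y z)) (volume.restrict (Icc (0:ℝ) 1)) :=
      hg.continuousOn.aestronglyMeasurable_comp_of_mem_posOrth ((h.meas y hy).const_add y)
        fun z hz => h.jump_mem_posOrth hz hy
    exact (h1.sub aestronglyMeasurable_const).sub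
      ((fderiv ℝ g y).continuous.measurable.comp (h.meas y hy)).aestronglyMeasurable
  · have h1 := (hG _ (h.jump_mem_box z hz y hy)).1
    have h2 := (hG _ (h.mem_box y hy)).1
    have h3 : ‖fderiv ℝ g y (ψ y z)‖ ≤ G * P :=
      ContinuousLinearMap.le_of_opNorm_le_of_le _ (hG _ (h.mem_box y hy)).2.1
        (h.norm_le z hz y hy)
    calc ‖g (y + ψ y z) - g y - fderiv ℝ g y (ψ y z)‖
        ≤ ‖g (y + ψ y z)‖ + ‖g y‖ + ‖fderiv ℝ g y (ψ y z)‖ :=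
          (norm_sub_le _ _).trans (add_le_add_left (norm_sub_le _ _) _)
      _ ≤ G + G + G * P := by gcongr
      _ ≤ _ := by nlinarith [mul_nonneg hG0 hP, mul_nonneg hG0 (sq_nonneg P)]
  · have hgy := contDiffAt_of_posOrth hg (h.mem_posOrth hy)
    have hD : ContDiffAt ℝ 2 (fderiv ℝ g) y := hgy.fderiv_right (by norm_num)
    exact ((h.contDiffAt_comp hg hz hy).sub (hgy.of_le (by norm_num))).sub
      (hD.clm_apply (h.smooth z hz y hy))
  · refine ContinuousLinearMap.opNorm_le_bound _ (by positivity) fun v => ?_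
    rw [h.fderiv_integrand hg hz hy]
    have h0 := h.norm_le z hz y hy
    have h1 := h.norm_fderiv_le z hz y hy
    have hj := hG _ (h.jump_mem_box z hz y hy)
    have hy' := hG _ (h.mem_box y hy)
    have hv : ‖fderiv ℝ (fun y => ψ y z) y v‖ ≤ P * ‖v‖ :=
      ContinuousLinearMap.le_of_opNorm_le _ h1 v
    have hv' : ‖v + fderiv ℝ (fun y => ψ y z) y v‖ ≤ ‖v‖ + P * ‖v‖ :=
      (norm_add_le _ _).trans (by linarith)
    have e1 := ContinuousLinearMap.le_of_opNorm_le_of_le _ hj.2.1 hv'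
    have e2 := ContinuousLinearMap.le_of_opNorm_le_of_le _ hy'.2.1 hv
    have e3 := ContinuousLinearMap.le_of_opNorm_le _ hy'.2.1 v
    have e4 : ‖d2 g y v (ψ y z)‖ ≤ G * ‖v‖ * P := ContinuousLinearMap.le_of_opNorm_le_of_le _
      (ContinuousLinearMap.le_of_opNorm_le _ hy'.2.2.1 v) h0
    refine (norm_sub_le _ _).trans ((add_le_add (norm_sub_le _ _) (norm_add_le _ _)).trans ?_)
    have hGv : 0 ≤ G * ‖v‖ := by positivity
    nlinarith [mul_nonneg hGv hP, mul_nonneg hGv (sq_nonneg P)]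
  · refine ContinuousLinearMap.opNorm_le_bound₂ _ (by positivity) fun v w => ?_
    rw [h.d2_integrand hg hz hy]
    have h0 := h.norm_le z hz y hy
    have h1 := h.norm_fderiv_le z hz y hy
    have h2 := h.norm_d2_le z hz y hy
    have hj := hG _ (h.jump_mem_box z hz y hy)
    have hy' := hG _ (h.mem_box y hy)
    have hv : ∀ v, ‖fderiv ℝ (fun y => ψ y z) y v‖ ≤ P * ‖v‖ :=
      fun v => ContinuousLinearMap.le_of_opNorm_le _ h1 v
    have hv' : ∀ v, ‖v + fderiv ℝ (fun y => ψ y z) y v‖ ≤ ‖v‖ + P * ‖v‖ :=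
      fun v => (norm_add_le _ _).trans (by linarith [hv v])
    have hvw : ‖d2 (fun y => ψ y z) y v w‖ ≤ P * ‖v‖ * ‖w‖ :=
      ContinuousLinearMap.le_of_opNorm_le _ (ContinuousLinearMap.le_of_opNorm_le _ h2 v) w
    have e1 := ContinuousLinearMap.le_of_opNorm_le_of_le _
      (ContinuousLinearMap.le_of_opNorm_le_of_le _ hj.2.2.1 (hv' v)) (hv' w)
    have e2 := ContinuousLinearMap.le_of_opNorm_le_of_le _ hj.2.1 hvw
    have e3 := ContinuousLinearMap.le_of_opNorm_le _
      (ContinuousLinearMap.le_of_opNorm_le _ hy'.2.2.1 v) w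
    have e4 := ContinuousLinearMap.le_of_opNorm_le_of_le _
      (ContinuousLinearMap.le_of_opNorm_le _
        (ContinuousLinearMap.le_of_opNorm_le _ hy'.2.2.2 v) w) h0
    have e5 := ContinuousLinearMap.le_of_opNorm_le_of_le _
      (ContinuousLinearMap.le_of_opNorm_le _ hy'.2.2.1 w) (hv v)
    have e6 := ContinuousLinearMap.le_of_opNorm_le_of_le _
      (ContinuousLinearMap.le_of_opNorm_le _ hy'.2.2.1 v) (hv w)
    have e7 := ContinuousLinearMap.le_of_opNorm_le_of_le _ hy'.2.1 hvw
    refine (norm_sub_le _ _).trans ((add_le_add ((norm_sub_le _ _).trans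
      (add_le_add_left (norm_add_le _ _) _)) ((norm_add_le _ _).trans
      (add_le_add_left ((norm_add_le _ _).trans
        (add_le_add_left (norm_add_le _ _) _)) _))).trans ?_)
    have hGv : 0 ≤ G * ‖v‖ * ‖w‖ := by positivity
    calc _ ≤ _ := add_le_add (add_le_add (add_le_add e1 e2) e3)
          (add_le_add (add_le_add (add_le_add e4 e5) e6) e7)
      _ = _ := by ring

theorem JumpJet.d2_integral_eq (h : JumpJet ψ x r P a b)
    (hg : ContDiffOn ℝ 4 g (posOrth n)) {v : Fin n → ℝ} (h1 : ∀ p, d2 g x v p = 0)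
    (h2 : ∀ p, d2 (fderiv ℝ g) x v v p = 0) :
    d2 (fun y => ∫ z in Icc (0:ℝ) 1, (g (y + ψ y z) - g y - fderiv ℝ g y (ψ y z))) x v v
      = ∫ z in Icc (0:ℝ) 1, jumpForm ψ g x v z ∧
    AEStronglyMeasurable (jumpForm ψ g x v) (volume.restrict (Icc (0:ℝ) 1)) := by
  obtain ⟨-, h3, h4⟩ := h.twiceDiffAt_integral hg
  have e : ∀ z ∈ Icc (0:ℝ) 1, d2 (fun y => g (y + ψ y z) - g y - fderiv ℝ g y (ψ y z)) x v v
      = jumpForm ψ g x v z := by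
    intro z hz
    rw [h.d2_integrand hg hz (mem_ball_self h.r_pos), h1, h1, h2, jumpForm]
    ring
  refine ⟨?_, (h4 v v).congr ((ae_restrict_iff' measurableSet_Icc).2 (Eventually.of_forall e))⟩
  rw [h3, setIntegral_congr_fun measurableSet_Icc e]

end Jump

section Convexity

variable {E : Type*} [NormedAddCommGroup E] [NormedSpace ℝ E] {O : Set E} {f : E → ℝ} {x : E}

theorem hasDerivAt_comp_line {f : E → ℝ} {p w : E} {s : ℝ}
    (h : DifferentiableAt ℝ f (p + s • w)) :
    HasDerivAt (fun s : ℝ => f (p + s • w)) (fderiv ℝ f (p + s • w) w) s := by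
  have h1 : HasDerivAt (fun s : ℝ => p + s • w) w s := by
    simpa using ((hasDerivAt_id s).smul_const w).const_add p
  exact h.hasFDerivAt.comp_hasDerivAt s h1

theorem hasDerivAt_fderiv_comp_line {f : E → ℝ} {p w : E} {s : ℝ}
    (h : DifferentiableAt ℝ (fderiv ℝ f) (p + s • w)) :
    HasDerivAt (fun s : ℝ => fderiv ℝ f (p + s • w) w) (d2 f (p + s • w) w w) s := by
  have h1 : HasDerivAt (fun s : ℝ => p + s • w) w s := by
    simpa using ((hasDerivAt_id s).smul_const w).const_add p
  have h2 : HasDerivAt (fun s : ℝ => fderiv ℝ f (p + s • w)) (d2 f (p + s • w) w) s :=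
    h.hasFDerivAt.comp_hasDerivAt s h1
  simpa using h2.clm_apply (hasDerivAt_const s w)

theorem convexOn_of_d2_nonneg (hO : IsOpen O) (hc : Convex ℝ O) (hf : ContDiffOn ℝ 2 f O)
    (h : ∀ y ∈ O, ∀ w, 0 ≤ d2 f y w w) : ConvexOn ℝ O f := by
  refine ⟨hc, fun p hp q hq a b ha hb hab => ?_⟩
  have hmem : ∀ s ∈ Icc (0:ℝ) 1, p + s • (q - p) ∈ O := fun s hs =>
    hc.add_smul_sub_mem hp hq hs
  have hd : ∀ s ∈ Icc (0:ℝ) 1, ContDiffAt ℝ 2 f (p + s • (q - p)) := fun s hs =>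
    hf.contDiffAt (hO.mem_nhds (hmem s hs))
  have h1 : ∀ s ∈ Icc (0:ℝ) 1, HasDerivAt (fun s : ℝ => f (p + s • (q - p)))
      (fderiv ℝ f (p + s • (q - p)) (q - p)) s := fun s hs =>
    hasDerivAt_comp_line ((hd s hs).differentiableAt (by simp))
  have h2 : ∀ s ∈ Icc (0:ℝ) 1, HasDerivAt (fun s : ℝ => fderiv ℝ f (p + s • (q - p)) (q - p))
      (d2 f (p + s • (q - p)) (q - p) (q - p)) s := fun s hs =>
    hasDerivAt_fderiv_comp_line (hd s hs).twiceDiffAt.2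
  have key := convexOn_of_hasDerivWithinAt2_nonneg (convex_Icc (0:ℝ) 1)
    (fun s hs => (h1 s hs).continuousAt.continuousWithinAt)
    (fun s hs => (h1 s (interior_subset hs)).hasDerivWithinAt)
    (fun s hs => (h2 s (interior_subset hs)).hasDerivWithinAt)
    (fun s hs => h _ (hmem s (interior_subset hs)) _)
  have h3 := key.2 (left_mem_Icc.2 zero_le_one) (right_mem_Icc.2 zero_le_one) ha hb hab
  have e : p + b • (q - p) = a • p + b • q := by
    rw [← eq_sub_iff_add_eq] at hab
    rw [hab]; module
  simpa [e] using h3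

theorem ConvexOn.d2_nonneg (hO : IsOpen O) (hf : ConvexOn ℝ O f) (hd : ContDiffOn ℝ 2 f O)
    {y : E} (hy : y ∈ O) (w : E) : 0 ≤ d2 f y w w := by
  have hcont : Continuous fun s : ℝ => y + s • w := by fun_prop
  have hn : (fun s : ℝ => y + s • w) ⁻¹' O ∈ 𝓝 (0:ℝ) :=
    hcont.continuousAt.preimage_mem_nhds (hO.mem_nhds (by simpa using hy))
  obtain ⟨δ, hδ, hball⟩ := Metric.mem_nhds_iff.1 hn
  have hmem : ∀ s ∈ ball (0:ℝ) δ, y + s • w ∈ O := fun s hs => hball hs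
  have hda : ∀ s ∈ ball (0:ℝ) δ, ContDiffAt ℝ 2 f (y + s • w) := fun s hs =>
    hd.contDiffAt (hO.mem_nhds (hmem s hs))
  have h1 : ∀ s ∈ ball (0:ℝ) δ, HasDerivAt (fun s : ℝ => f (y + s • w))
      (fderiv ℝ f (y + s • w) w) s := fun s hs =>
    hasDerivAt_comp_line ((hda s hs).differentiableAt (by simp))
  have hc : ConvexOn ℝ (ball (0:ℝ) δ) (fun s : ℝ => f (y + s • w)) := by
    refine ⟨convex_ball _ _, fun s hs u hu a b ha hb hab => ?_⟩
    have := hf.2 (hmem s hs) (hmem u hu) ha hb hab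
    have e : y + (a • s + b • u) • w = a • (y + s • w) + b • (y + u • w) := by
      rw [← eq_sub_iff_add_eq] at hab
      rw [hab]; module
    simpa only [e] using this
  have hmono : MonotoneOn (fun s : ℝ => fderiv ℝ f (y + s • w) w) (ball (0:ℝ) δ) := by
    have := hc.monotoneOn_deriv fun s hs => (h1 s hs).differentiableAt
    intro s hs u hu hsu
    have h3 := this hs hu hsu
    rwa [(h1 s hs).deriv, (h1 u hu).deriv] at h3
  have h0 : (0:ℝ) ∈ ball (0:ℝ) δ := mem_ball_self hδ
  have h2 := hasDerivAt_fderiv_comp_line (hda 0 h0).twiceDiffAt.2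
  have h3 := h2.hasDerivWithinAt (s := ball (0:ℝ) δ)
  have hmono' := hmono.derivWithin_nonneg (x := 0)
  rw [h3.derivWithin (isOpen_ball.uniqueDiffWithinAt h0)] at hmono'
  simpa using hmono'

theorem d2_symm {F : Type*} [NormedAddCommGroup F] [NormedSpace ℝ F] {f : E → F}
    (h : ContDiffAt ℝ 2 f x) (v w : E) : d2 f x v w = d2 f x w v :=
  h.isSymmSndFDerivAt (by simp) v w

theorem d2_apply_eq_zero_of_degenerate (h : ContDiffAt ℝ 2 f x)
    (hpos : ∀ w, 0 ≤ d2 f x w w) {v : E} (hv : d2 f x v v = 0) (p : E) : d2 f x v p = 0 := by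
  by_contra hne
  have key : ∀ s : ℝ, 0 ≤ 2 * s * d2 f x v p + d2 f x p p := by
    intro s
    have := hpos (s • v + p)
    simp only [map_add, map_smul, _root_.add_apply, _root_.smul_apply, smul_eq_mul, hv,
      d2_symm h p v] at this
    linarith
  have := key (-(d2 f x p p + 1) / (2 * d2 f x v p))
  have e : 2 * (-(d2 f x p p + 1) / (2 * d2 f x v p)) * d2 f x v p = -(d2 f x p p + 1) := by
    field_simp
  linarith

set_option maxSynthPendingDepth 3 in
theorem d2_fderiv_eq_zero_of_degenerate (h : ContDiffAt ℝ 4 f x) {v : E}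
    (hpos : ∀ᶠ y in 𝓝 x, 0 ≤ d2 f y v v) (hv : d2 f x v v = 0) (p : E) :
    d2 (fderiv ℝ f) x v v p = 0 := by
  have h1 : ContDiffAt ℝ 3 (fderiv ℝ f) x := h.fderiv_right (by norm_num)
  have h2 : ContDiffAt ℝ 2 (d2 f) x := h1.fderiv_right (by norm_num)
  have h2' : DifferentiableAt ℝ (d2 f) x := h2.differentiableAt (by simp)
  have h3 : ∀ u, DifferentiableAt ℝ (fun y => d2 f y u) x := fun u =>
    h2'.clm_apply (differentiableAt_const u)
  have e : ∀ u w q, fderiv ℝ (fun y => d2 f y u w) x q = d2 (fderiv ℝ f) x q u w := by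
    intro u w q
    rw [fderiv_clm_apply (h3 u) (differentiableAt_const w),
      fderiv_clm_apply h2' (differentiableAt_const u)]
    simp [d2]; rfl
  have hmin : IsLocalMin (fun y => d2 f y v v) x := by
    filter_upwards [hpos] with y hy
    simpa [hv] using hy
  have hz := DFunLike.congr_fun hmin.fderiv_eq_zero p
  rw [e] at hz
  have hs : (fun y => d2 f y v p) =ᶠ[𝓝 x] fun y => d2 f y p v := by
    filter_upwards [(h.of_le (by norm_num : (2:WithTop ℕ∞) ≤ 4)).eventually (by simp)] with y hy
      using d2_symm hy v p
  rw [← e, hs.fderiv_eq, e, d2_symm (h1.of_le (by norm_num))]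
  simpa using hz

end Convexity

section Operators

variable {n : ℕ} {T : ℝ} {x : Fin n → ℝ} {t : ℝ}

theorem twiceDiffAt_Bop (K : JumpKernel n T) (lam : ℝ → ℝ) (hx : x ∈ posOrth n)
    (ht : t ∈ Icc (0:ℝ) T) {g : (Fin n → ℝ) → ℝ} (hg : ContDiffOn ℝ 4 g (posOrth n)) :
    TwiceDiffAt (fun y => Bop lam K g y t) x := by
  obtain ⟨r, P, a, b, h⟩ := K.exists_jumpJet hx ht
  exact (h.twiceDiffAt_integral hg).1.const_smul (lam t)

theorem dir2_Bop (K : JumpKernel n T) (lam : ℝ → ℝ) (hx : x ∈ posOrth n)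
    (ht : t ∈ Icc (0:ℝ) T) {g : (Fin n → ℝ) → ℝ} (hg : ContDiffOn ℝ 4 g (posOrth n))
    {v : Fin n → ℝ} (h1 : ∀ p, d2 g x v p = 0) (h2 : ∀ p, d2 (fderiv ℝ g) x v v p = 0) :
    dir2 (fun y => Bop lam K g y t) x v
      = lam t * ∫ z in Icc (0:ℝ) 1, jumpForm (fun y z => K.φ y t z) g x v z := by
  obtain ⟨r, P, a, b, h⟩ := K.exists_jumpJet hx ht
  rw [dir2_eq_d2 (twiceDiffAt_Bop K lam hx ht hg).2, ← (h.d2_integral_eq hg h1 h2).1]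
  have := d2_const_smul (h.twiceDiffAt_integral hg).1 (lam t)
  exact DFunLike.congr_fun (DFunLike.congr_fun this v) v

theorem contDiffAt_dmix {g : (Fin n → ℝ) → ℝ} (hg : ContDiffAt ℝ 4 g x) (v w : Fin n → ℝ) :
    ContDiffAt ℝ 2 (fun y => dmix g y v w) x :=
  (((hg.fderiv_right (m := 3) (by norm_num)).clm_apply contDiffAt_const).fderiv_right (m := 2)
    (by norm_num)).clm_apply contDiffAt_const

theorem twiceDiffAt_Aop (Dk : DiffKernel n T) (hx : x ∈ posOrth n)
    (ht : t ∈ Icc (0:ℝ) T) {g : (Fin n → ℝ) → ℝ} (hg : ContDiffOn ℝ 4 g (posOrth n)) :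
    TwiceDiffAt (fun y => Aop Dk g y t) x := by
  refine ContDiffAt.twiceDiffAt ?_
  have hβ : ∀ i j, ContDiffAt ℝ 2 (fun y => Dk.β y t i j) x := fun i j =>
    contDiffAt_of_posOrth (Dk.smooth t ht i j) hx
  refine ContDiffAt.sum fun i _ => ContDiffAt.sum fun j _ => ContDiffAt.mul ?_
    (contDiffAt_dmix (contDiffAt_of_posOrth hg hx) _ _)
  simp only [Matrix.mul_apply, Matrix.transpose_apply]
  exact (ContDiffAt.sum fun k _ => (hβ i k).mul (hβ j k)).div_const 2

theorem dir2_Aop_congr (Dk : DiffKernel n T) {f g : (Fin n → ℝ) → ℝ}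
    {L : (Fin n → ℝ) →L[ℝ] ℝ} (h : ∀ᶠ y in 𝓝 x, fderiv ℝ f y = fderiv ℝ g y + L)
    (v : Fin n → ℝ) :
    dir2 (fun y => Aop Dk f y t) x v = dir2 (fun y => Aop Dk g y t) x v := by
  have h1 : (fun y => Aop Dk f y t) =ᶠ[𝓝 x] fun y => Aop Dk g y t := by
    filter_upwards [h.eventually_nhds] with y hy
    have : ∀ u w, dmix f y u w = dmix g y u w := by
      intro u w
      have e : (fun y => fderiv ℝ f y u) =ᶠ[𝓝 y] fun y => fderiv ℝ g y u + L u := by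
        filter_upwards [hy] with y' hy'
        rw [hy', _root_.add_apply]
      rw [dmix, e.fderiv_eq, fderiv_add_const]
      rfl
    simp only [Aop, this]
  have h2 : (fun y => fderiv ℝ (fun y => Aop Dk f y t) y v)
      =ᶠ[𝓝 x] fun y => fderiv ℝ (fun y => Aop Dk g y t) y v :=
    (h1.fderiv (𝕜 := ℝ)).mono fun _ hy => DFunLike.congr_fun hy v
  rw [dir2, dmix, h2.fderiv_eq]
  rfl

theorem dir2_Aop_eq_zero (Dk : DiffKernel n T) {f : (Fin n → ℝ) → ℝ}
    (h : ∀ᶠ y in 𝓝 x, fderiv ℝ f y = 0) (v : Fin n → ℝ) :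
    dir2 (fun y => Aop Dk f y t) x v = 0 := by
  rw [dir2_Aop_congr Dk (f := f) (g := 0) (L := 0) (h.mono fun y hy => by simp [hy])]
  have e : (fun y => Aop Dk (0 : (Fin n → ℝ) → ℝ) y t) = 0 := by
    funext y
    simp [Aop, dmix]
  rw [e]
  simp [dir2, dmix]

theorem dir2_add {F G : (Fin n → ℝ) → ℝ} (hF : TwiceDiffAt F x) (hG : TwiceDiffAt G x)
    (v : Fin n → ℝ) : dir2 (fun y => F y + G y) x v = dir2 F x v + dir2 G x v := by
  rw [dir2_eq_d2 (hF.add hG).2, dir2_eq_d2 hF.2, dir2_eq_d2 hG.2, d2_add hF hG]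
  simp

theorem dir2_Aop_add_Bop (K : JumpKernel n T) (Dk : DiffKernel n T) (lam : ℝ → ℝ)
    (hx : x ∈ posOrth n) (ht : t ∈ Icc (0:ℝ) T) {g : (Fin n → ℝ) → ℝ}
    (hg : ContDiffOn ℝ 4 g (posOrth n)) (v : Fin n → ℝ) :
    dir2 (fun y => Aop Dk g y t + Bop lam K g y t) x v
      = dir2 (fun y => Aop Dk g y t) x v + dir2 (fun y => Bop lam K g y t) x v :=
  dir2_add (twiceDiffAt_Aop Dk hx ht hg) (twiceDiffAt_Bop K lam hx ht hg) v

end Operators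

section OneDim

/-- A smooth even density equal to `1` on `2 ≤ |s| ≤ 10` and supported in `1 ≤ |s| ≤ 11`. -/
theorem exists_annular_bump : ∃ b : ℝ → ℝ, ContDiff ℝ ∞ b ∧ Integrable b ∧ (∀ s, 0 ≤ b s) ∧
    (∀ s, b s ≤ 2) ∧ (∀ s, 2 ≤ |s| → |s| ≤ 10 → 1 ≤ b s) ∧ (∀ s, |s| ≤ 1 → b s = 0) ∧
    ∀ s, 11 ≤ |s| → b s = 0 := by
  let f : ContDiffBump (6:ℝ) := ⟨4, 5, by norm_num, by norm_num⟩
  let g : ContDiffBump (-6:ℝ) := ⟨4, 5, by norm_num, by norm_num⟩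
  refine ⟨fun s => f s + g s, f.contDiff.add g.contDiff, f.integrable.add g.integrable,
    fun s => add_nonneg f.nonneg g.nonneg,
    fun s => by linarith [f.le_one (x := s), g.le_one (x := s)], fun s h1 h2 => ?_,
    fun s h => ?_, fun s h => ?_⟩
  · rcases le_total 0 s with hs | hs
    · rw [abs_of_nonneg hs] at h1 h2
      have : f s = 1 := f.one_of_mem_closedBall (by
        rw [mem_closedBall, Real.dist_eq, abs_le]; constructor <;> simp only [f] <;> linarith)
      linarith [g.nonneg (x := s)]
    · rw [abs_of_nonpos hs] at h1 h2
      have : g s = 1 := g.one_of_mem_closedBall (by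
        rw [mem_closedBall, Real.dist_eq, abs_le]; constructor <;> simp only [g] <;> linarith)
      linarith [f.nonneg (x := s)]
  · rw [abs_le] at h
    dsimp only
    rw [f.zero_of_le_dist, g.zero_of_le_dist, add_zero]
    · rw [Real.dist_eq, le_abs]; left; simp only [g]; linarith
    · rw [Real.dist_eq, le_abs]; right; simp only [f]; linarith
  · dsimp only
    rw [f.zero_of_le_dist, g.zero_of_le_dist, add_zero]
    all_goals
      rw [le_abs] at h
      rw [Real.dist_eq, le_abs]
      simp only [f, g]
    · rcases h with h | h
      · left; linarith
      · right; linarith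
    · rcases h with h | h
      · left; linarith
      · right; linarith

/-- A convex smooth function of one variable, flat near `0`, with prescribed convexity on
`2 ≤ |s| ≤ 10` and affine beyond `|s| = 11`. -/
theorem exists_convex_profile : ∃ (κ κ' b : ℝ → ℝ) (C : ℝ), ContDiff ℝ ∞ κ ∧
    (∀ s, HasDerivAt κ (κ' s) s) ∧ (∀ s, HasDerivAt κ' (b s) s) ∧ (∀ s, 0 ≤ b s) ∧
    (∀ s, b s ≤ C) ∧ (∀ s, |κ' s| ≤ C) ∧ (∀ s, 2 ≤ |s| → |s| ≤ 10 → 1 ≤ b s) ∧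
    (∀ s, |s| ≤ 1 → κ s = 0) ∧ b 0 = 0 ∧ ∀ s, 11 ≤ |s| → b s = 0 := by
  obtain ⟨b, hb, hi, h0, h2, h1, hz, hz'⟩ := exists_annular_bump
  have hbc : Continuous b := hb.continuous
  have hd1 : ∀ s, HasDerivAt (fun s => ∫ u in (0:ℝ)..s, b u) (b s) s := fun s =>
    (hbc.integral_hasStrictDerivAt 0 s).hasDerivAt
  have hc1 : Continuous fun s => ∫ u in (0:ℝ)..s, b u :=
    continuous_iff_continuousAt.2 fun s => (hd1 s).continuousAt
  have hd0 : ∀ s, HasDerivAt (fun s => ∫ w in (0:ℝ)..s, ∫ u in (0:ℝ)..w, b u)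
      (∫ u in (0:ℝ)..s, b u) s := fun s =>
    (hc1.integral_hasStrictDerivAt 0 s).hasDerivAt
  have hsm1 : ContDiff ℝ ∞ fun s => ∫ u in (0:ℝ)..s, b u := by
    rw [contDiff_infty_iff_deriv]
    refine ⟨fun s => (hd1 s).differentiableAt, ?_⟩
    rwa [show deriv (fun s => ∫ u in (0:ℝ)..s, b u) = b from funext fun s => (hd1 s).deriv]
  have hsm0 : ContDiff ℝ ∞ fun s => ∫ w in (0:ℝ)..s, ∫ u in (0:ℝ)..w, b u := by
    rw [contDiff_infty_iff_deriv]
    refine ⟨fun s => (hd0 s).differentiableAt, ?_⟩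
    rwa [show deriv (fun s => ∫ w in (0:ℝ)..s, ∫ u in (0:ℝ)..w, b u) = _ from
      funext fun s => (hd0 s).deriv]
  have hle : ∀ s u : ℝ, |s| ≤ 1 → u ∈ uIcc 0 s → |u| ≤ 1 := by
    intro s u hs hu
    have := abs_sub_left_of_mem_uIcc hu
    simp only [sub_zero] at this
    exact this.trans hs
  have hz1 : ∀ s : ℝ, |s| ≤ 1 → ∫ u in (0:ℝ)..s, b u = 0 := fun s hs => by
    rw [intervalIntegral.integral_congr (g := fun _ => (0:ℝ)) fun u hu => hz u (hle s u hs hu)]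
    simp
  refine ⟨_, _, b, 2 + ∫ u, b u, hsm0, hd0, hd1, h0, fun s => ?_, fun s => ?_, h1,
    fun s hs => ?_, hz 0 (by simp), hz'⟩
  · linarith [h2 s, integral_nonneg (μ := volume) (f := b) fun s => h0 s]
  · have e := intervalIntegral.norm_integral_le_integral_norm_uIoc (f := b) (μ := volume)
      (a := 0) (b := s)
    have e2 : ∫ u in uIoc 0 s, ‖b u‖ ≤ ∫ u, ‖b u‖ :=
      setIntegral_le_integral hi.norm (Eventually.of_forall fun u => norm_nonneg _)
    have e3 : ∫ u, ‖b u‖ = ∫ u, b u := by simp only [Real.norm_of_nonneg (h0 _)]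
    rw [Real.norm_eq_abs] at e
    linarith
  · rw [intervalIntegral.integral_congr (g := fun _ => (0:ℝ)) fun u hu => hz1 u (hle s u hs hu)]
    simp

end OneDim

section Compensator

variable {n : ℕ}

/-- A smooth convex function on `ℝⁿ`, flat near the origin, uniformly convex on the annulus
`1 ≤ ‖Y‖ ≤ 2`, whose Hessian vanishes far out on each ray. -/
structure IsCompensator (k : (Fin n → ℝ) → ℝ) (ρ C : ℝ) : Prop where
  smooth : ContDiff ℝ ∞ k
  rho_pos : 0 < ρ
  flat : ∀ Y, ‖Y‖ < ρ → k Y = 0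
  d2_nonneg : ∀ Y v, 0 ≤ d2 k Y v v
  d2_ge : ∀ Y, 1 ≤ ‖Y‖ → ‖Y‖ ≤ 2 → ∀ v, ‖v‖ ^ 2 ≤ 25 * d2 k Y v v
  norm_fderiv_le : ∀ Y, ‖fderiv ℝ k Y‖ ≤ C
  norm_d2_le : ∀ Y, ‖d2 k Y‖ ≤ C
  ray : ∀ Y, ∀ᶠ ε in 𝓝[>] (0:ℝ), d2 k (ε⁻¹ • Y) = 0

/-- The linear form `Y ↦ 4 Yᵢ + Yⱼ`. -/
def obliqueForm (i j : Fin n) : (Fin n → ℝ) →L[ℝ] ℝ :=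
  (4:ℝ) • ContinuousLinearMap.proj i + ContinuousLinearMap.proj j

theorem obliqueForm_apply (i j : Fin n) (Y : Fin n → ℝ) :
    obliqueForm i j Y = 4 * Y i + Y j := by
  simp [obliqueForm]

theorem abs_obliqueForm_le (i j : Fin n) (Y : Fin n → ℝ) : |obliqueForm i j Y| ≤ 5 * ‖Y‖ := by
  rw [obliqueForm_apply]
  have h1 := norm_le_pi_norm Y i
  have h2 := norm_le_pi_norm Y j
  rw [Real.norm_eq_abs, abs_le] at h1 h2
  rw [abs_le]
  constructor <;> linarith [h1.1, h1.2, h2.1, h2.2]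

theorem exists_abs_eq_norm {Y : Fin n → ℝ} (hY : 0 < ‖Y‖) : ∃ i, |Y i| = ‖Y‖ := by
  by_contra! h
  have : ‖Y‖ < ‖Y‖ := (pi_norm_lt_iff hY).2 fun i =>
    lt_of_le_of_ne (norm_le_pi_norm Y i) (h i)
  exact lt_irrefl _ this

theorem sq_norm_le_sum_sq_obliqueForm (i : Fin n) (v : Fin n → ℝ) :
    ‖v‖ ^ 2 ≤ 25 * ∑ j, obliqueForm i j v ^ 2 := by
  rcases (norm_nonneg v).eq_or_lt with h0 | h0
  · rw [← h0]; simp only [ne_eq, OfNat.ofNat_ne_zero, not_false_eq_true, zero_pow]; positivity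
  obtain ⟨j, hj⟩ := exists_abs_eq_norm h0
  have hle : ∀ j, obliqueForm i j v ^ 2 ≤ ∑ j, obliqueForm i j v ^ 2 := fun j =>
    Finset.single_le_sum (f := fun j => obliqueForm i j v ^ 2) (fun _ _ => sq_nonneg _)
      (Finset.mem_univ j)
  have h1 := hle i
  have h2 := hle j
  rw [obliqueForm_apply] at h1 h2
  rw [← hj, sq_abs]
  nlinarith [sq_nonneg (v j + 5 * v i), sq_nonneg (v j), sq_nonneg (v i),
    sq_nonneg (5 * v i), sq_nonneg (v j + 4 * v i), sq_nonneg (v j + 8 * v i)]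

set_option maxSynthPendingDepth 3 in
theorem exists_isCompensator (n : ℕ) : ∃ (k : (Fin n → ℝ) → ℝ) (ρ C : ℝ),
    IsCompensator k ρ C := by
  obtain ⟨κ, κ', b, C, hκ, h1, h2, hb0, hbC, hκC, hb1, hflat, hb00, hbz⟩ := exists_convex_profile
  have hC : 0 ≤ C := (hb0 0).trans (hbC 0)
  set k : (Fin n → ℝ) → ℝ := fun Y => ∑ i, ∑ j, κ (obliqueForm i j Y) with hk
  have hd1 : ∀ Y, HasFDerivAt k (∑ i, ∑ j, κ' (obliqueForm i j Y) • obliqueForm i j) Y :=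
    fun Y => HasFDerivAt.fun_sum fun i _ => HasFDerivAt.fun_sum fun j _ =>
      (h1 _).comp_hasFDerivAt Y (obliqueForm i j).hasFDerivAt
  have e1 : fderiv ℝ k = fun Y => ∑ i, ∑ j, κ' (obliqueForm i j Y) • obliqueForm i j :=
    funext fun Y => (hd1 Y).fderiv
  have e2 : ∀ Y, d2 k Y = ∑ i, ∑ j,
      (b (obliqueForm i j Y) • obliqueForm i j).smulRight (obliqueForm i j) := fun Y => by
    rw [d2, e1]
    exact (HasFDerivAt.fun_sum fun i _ => HasFDerivAt.fun_sum fun j _ =>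
      ((h2 _).comp_hasFDerivAt Y (obliqueForm i j).hasFDerivAt).smul_const _).fderiv
  have e3 : ∀ Y v w, d2 k Y v w = ∑ i, ∑ j,
      b (obliqueForm i j Y) * obliqueForm i j v * obliqueForm i j w := fun Y v w => by
    simp [e2, _root_.sum_apply]
  have hn : ∀ i j : Fin n, ‖obliqueForm i j‖ ≤ 5 := fun i j =>
    ContinuousLinearMap.opNorm_le_bound _ (by norm_num) fun v => abs_obliqueForm_le i j v
  refine ⟨k, 1 / 5, ∑ i : Fin n, ∑ j : Fin n, C * 25, ?_, by norm_num, fun Y hY => ?_,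
    fun Y v => ?_, fun Y h1Y h2Y v => ?_, fun Y => ?_, fun Y => ?_, fun Y => ?_⟩
  · exact ContDiff.sum fun i _ => ContDiff.sum fun j _ => hκ.comp (obliqueForm i j).contDiff
  · refine Finset.sum_eq_zero fun i _ => Finset.sum_eq_zero fun j _ => hflat _ ?_
    linarith [abs_obliqueForm_le i j Y]
  · rw [e3]
    refine Finset.sum_nonneg fun i _ => Finset.sum_nonneg fun j _ => ?_
    rw [mul_assoc]
    exact mul_nonneg (hb0 _) (mul_self_nonneg _)
  · obtain ⟨i, hi⟩ := exists_abs_eq_norm (Y := Y) (by linarith)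
    have hbi : ∀ j, 1 ≤ b (obliqueForm i j Y) := fun j => by
      have hj := norm_le_pi_norm Y j
      rw [Real.norm_eq_abs] at hj
      refine hb1 _ ?_ ?_
      · rw [obliqueForm_apply]
        have := abs_sub_abs_le_abs_sub (4 * Y i) (-Y j)
        rw [abs_neg, sub_neg_eq_add, abs_mul, abs_of_pos (by norm_num : (0:ℝ) < 4)] at this
        linarith
      · linarith [abs_obliqueForm_le i j Y]
    refine (sq_norm_le_sum_sq_obliqueForm i v).trans ?_
    rw [e3]
    refine mul_le_mul_of_nonneg_left ?_ (by norm_num)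
    calc ∑ j, obliqueForm i j v ^ 2
        ≤ ∑ j, b (obliqueForm i j Y) * obliqueForm i j v * obliqueForm i j v := by
          refine Finset.sum_le_sum fun j _ => ?_
          nlinarith [hbi j, mul_self_nonneg (obliqueForm i j v)]
      _ ≤ _ := Finset.single_le_sum (f := fun i => ∑ j, b (obliqueForm i j Y) *
          obliqueForm i j v * obliqueForm i j v) (fun i _ => Finset.sum_nonneg fun j _ => by
            rw [mul_assoc]
            exact mul_nonneg (hb0 _) (mul_self_nonneg _)) (Finset.mem_univ i)
  · rw [e1]
    refine norm_sum_le_of_le _ fun i _ => norm_sum_le_of_le _ fun j _ => ?_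
    rw [norm_smul]
    have := hn i j
    calc ‖κ' (obliqueForm i j Y)‖ * ‖obliqueForm i j‖ ≤ C * 5 := by
          gcongr
          exact hκC _
      _ ≤ C * 25 := by gcongr; norm_num
  · rw [e2]
    refine norm_sum_le_of_le _ fun i _ => norm_sum_le_of_le _ fun j _ => ?_
    rw [ContinuousLinearMap.norm_smulRight_apply, norm_smul]
    have := hn i j
    have hb : ‖b (obliqueForm i j Y)‖ ≤ C := by
      rw [Real.norm_of_nonneg (hb0 _)]; exact hbC _
    calc ‖b (obliqueForm i j Y)‖ * ‖obliqueForm i j‖ * ‖obliqueForm i j‖ ≤ C * 5 * 5 := by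
          gcongr
      _ = C * 25 := by ring
  · have : ∀ i j : Fin n, ∀ᶠ ε in 𝓝[>] (0:ℝ), b (obliqueForm i j (ε⁻¹ • Y)) = 0 := by
      intro i j
      rcases eq_or_ne (obliqueForm i j Y) 0 with h | h
      · exact Eventually.of_forall fun ε => by rw [map_smul, h, smul_zero, hb00]
      · have ht : Tendsto (fun ε : ℝ => ε⁻¹ * |obliqueForm i j Y|) (𝓝[>] 0) atTop :=
          tendsto_inv_nhdsGT_zero.atTop_mul_const (abs_pos.2 h)
        filter_upwards [ht.eventually_ge_atTop 11, self_mem_nhdsWithin] with ε hε hε0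
        refine hbz _ ?_
        rw [map_smul, smul_eq_mul, abs_mul, abs_of_pos (inv_pos.2 hε0)]
        exact hε
    filter_upwards [eventually_all.2 fun i => eventually_all.2 (this i)] with ε hε
    rw [e2]
    exact Finset.sum_eq_zero fun i _ => Finset.sum_eq_zero fun j _ => by rw [hε i j]; simp

end Compensator

section Rescale

variable {n : ℕ} {h : (Fin n → ℝ) → ℝ}

theorem hasFDerivAt_smul_sub (c : ℝ) (x y : Fin n → ℝ) :
    HasFDerivAt (fun y => c • (y - x)) (c • ContinuousLinearMap.id ℝ (Fin n → ℝ)) y :=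
  ((hasFDerivAt_id y).sub_const x).const_smul c

theorem fderiv_rescale (hh : ContDiff ℝ 2 h) (c : ℝ) (x y : Fin n → ℝ) :
    fderiv ℝ (fun y => h (c • (y - x))) y = c • fderiv ℝ h (c • (y - x)) := by
  have h1 : HasFDerivAt h (fderiv ℝ h (c • (y - x))) (c • (y - x)) :=
    (hh.differentiable (by simp) _).hasFDerivAt
  have h2 := HasFDerivAt.comp y h1 (hasFDerivAt_smul_sub c x y)
  rw [show (fun y => h (c • (y - x))) = h ∘ fun y => c • (y - x) from rfl, h2.fderiv]
  ext v; simp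

set_option maxSynthPendingDepth 3 in
theorem d2_rescale (hh : ContDiff ℝ 2 h) (c : ℝ) (x y : Fin n → ℝ) :
    d2 (fun y => h (c • (y - x))) y = (c * c) • d2 h (c • (y - x)) := by
  have h1 : HasFDerivAt (fderiv ℝ h) (d2 h (c • (y - x))) (c • (y - x)) :=
    (hh.contDiffAt.twiceDiffAt (x := c • (y - x))).2.hasFDerivAt
  have h2 := (HasFDerivAt.comp y h1 (hasFDerivAt_smul_sub c x y)).const_smul c
  have e : fderiv ℝ (fun y => h (c • (y - x))) = c • (fderiv ℝ h ∘ fun y => c • (y - x)) :=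
    funext fun y => fderiv_rescale hh c x y
  rw [d2, e, h2.fderiv]
  ext v w; simp [mul_assoc]

theorem contDiff_rescale {m : WithTop ℕ∞} (hh : ContDiff ℝ m h) (c : ℝ) (x : Fin n → ℝ) :
    ContDiff ℝ m (fun y => h (c • (y - x))) :=
  hh.comp ((contDiff_id.sub contDiff_const).const_smul c)

end Rescale

theorem d2_mul {E : Type*} [NormedAddCommGroup E] [NormedSpace ℝ E] {f g : E → ℝ} {x : E}
    (hf : ContDiffAt ℝ 2 f x) (hg : ContDiffAt ℝ 2 g x) (v w : E) :
    d2 (fun y => f y * g y) x v w = f x * d2 g x v w + fderiv ℝ f x v * fderiv ℝ g x w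
      + g x * d2 f x v w + fderiv ℝ g x v * fderiv ℝ f x w := by
  have e : fderiv ℝ (fun y => f y * g y)
      =ᶠ[𝓝 x] fun y => f y • fderiv ℝ g y + g y • fderiv ℝ f y := by
    filter_upwards [hf.twiceDiffAt.1, hg.twiceDiffAt.1] with y h1 h2
    exact fderiv_fun_mul h1 h2
  have hf1 : DifferentiableAt ℝ f x := hf.differentiableAt (by simp)
  have hg1 : DifferentiableAt ℝ g x := hg.differentiableAt (by simp)
  have h3 := (hf1.hasFDerivAt.fun_smul hg.twiceDiffAt.2.hasFDerivAt).add
    (hg1.hasFDerivAt.fun_smul hf.twiceDiffAt.2.hasFDerivAt)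
  have h4 := e.fderiv_eq (𝕜 := ℝ)
  rw [d2, h4]
  erw [h3.fderiv]
  simp [d2]
  ring

section Cut

variable {n : ℕ}

/-- A smooth cutoff, equal to `1` on the unit ball and vanishing beyond radius `3/2`. -/
structure IsCutoff (χ : (Fin n → ℝ) → ℝ) (X : ℝ) : Prop where
  smooth : ContDiff ℝ ∞ χ
  one : ∀ Y, ‖Y‖ < 1 → χ Y = 1
  zero : ∀ Y, 3 / 2 ≤ ‖Y‖ → χ Y = 0
  abs_le : ∀ Y, |χ Y| ≤ 1
  norm_fderiv_le : ∀ Y, ‖fderiv ℝ χ Y‖ ≤ X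
  norm_d2_le : ∀ Y, ‖d2 χ Y‖ ≤ X

set_option maxSynthPendingDepth 3 in
theorem exists_isCutoff (n : ℕ) : ∃ (χ : (Fin n → ℝ) → ℝ) (X : ℝ), IsCutoff χ X := by
  let f : ContDiffBump (0 : Fin n → ℝ) := ⟨1, 3 / 2, by norm_num, by norm_num⟩
  have hs : ContDiff ℝ ∞ f := f.contDiff
  have c1 : HasCompactSupport (fderiv ℝ f) := f.hasCompactSupport.fderiv ℝ
  have c2 : HasCompactSupport (d2 f) := c1.fderiv ℝ
  have hs1 : ContDiff ℝ ∞ (fderiv ℝ f) := hs.fderiv_right (by simp)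
  have hs2 : ContDiff ℝ ∞ (d2 f) := hs1.fderiv_right (by simp)
  obtain ⟨X1, h1⟩ := c1.exists_bound_of_continuous hs1.continuous
  obtain ⟨X2, h2⟩ := c2.exists_bound_of_continuous hs2.continuous
  refine ⟨f, max X1 X2, hs, fun Y hY => f.one_of_mem_closedBall ?_, fun Y hY =>
    f.zero_of_le_dist ?_, fun Y => ?_, fun Y => (h1 Y).trans (le_max_left _ _),
    fun Y => (h2 Y).trans (le_max_right _ _)⟩
  · rw [mem_closedBall, dist_zero_right]; exact hY.le
  · rw [dist_zero_right]; exact hY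
  · rw [abs_of_nonneg f.nonneg]; exact f.le_one

/-- The localization of `f` to the ball of radius `3ε/2` around `x`. -/
def cut (χ : (Fin n → ℝ) → ℝ) (x : Fin n → ℝ) (ε : ℝ) (f : (Fin n → ℝ) → ℝ) (y : Fin n → ℝ) :
    ℝ :=
  χ (ε⁻¹ • (y - x)) * f y

/-- `f` is smooth and convex (in the Hessian sense) on the orthant, vanishes to first order at
`x`, and has Hessian bounded by `M` at distance at most `2ε` from `x`. -/
structure IsGerm (f : (Fin n → ℝ) → ℝ) (x : Fin n → ℝ) (ε M : ℝ) : Prop where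
  smooth : ContDiffOn ℝ 4 f (posOrth n)
  d2_nonneg : ∀ y ∈ posOrth n, ∀ v, 0 ≤ d2 f y v v
  apply_eq : f x = 0
  fderiv_eq : fderiv ℝ f x = 0
  eps_pos : 0 < ε
  ball_subset : closedBall x (2 * ε) ⊆ posOrth n
  norm_d2_le : ∀ y ∈ closedBall x (2 * ε), ‖d2 f y‖ ≤ M

variable {f χ k : (Fin n → ℝ) → ℝ} {x : Fin n → ℝ} {ε M X ρ C : ℝ}

theorem norm_inv_smul_sub (hε : 0 < ε) (y : Fin n → ℝ) : ‖ε⁻¹ • (y - x)‖ = ‖y - x‖ / ε := by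
  rw [norm_smul, Real.norm_of_nonneg (inv_nonneg.2 hε.le)]; field_simp

theorem IsGerm.mem (hf : IsGerm f x ε M) : x ∈ posOrth n :=
  hf.ball_subset (mem_closedBall_self (by linarith [hf.eps_pos]))

set_option maxSynthPendingDepth 3 in
theorem IsGerm.M_nonneg (hf : IsGerm f x ε M) : 0 ≤ M :=
  (norm_nonneg _).trans (hf.norm_d2_le x (mem_closedBall_self (by linarith [hf.eps_pos])))

set_option maxSynthPendingDepth 3 in
theorem IsGerm.norm_fderiv_le (hf : IsGerm f x ε M) {y : Fin n → ℝ}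
    (hy : y ∈ closedBall x (2 * ε)) : ‖fderiv ℝ f y‖ ≤ 2 * M * ε := by
  have hε := hf.eps_pos
  have h := (convex_closedBall x (2 * ε)).norm_image_sub_le_of_norm_fderiv_le (𝕜 := ℝ)
    (f := fderiv ℝ f) (C := M) (x := x) (y := y) (fun p hp =>
      ((contDiffAt_of_posOrth hf.smooth (hf.ball_subset hp)).of_le
        (by norm_num)).twiceDiffAt.2) hf.norm_d2_le (mem_closedBall_self (by linarith)) hy
  rw [hf.fderiv_eq, sub_zero] at h
  rw [mem_closedBall_iff_norm] at hy
  nlinarith [hf.M_nonneg]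

theorem IsGerm.abs_le (hf : IsGerm f x ε M) {y : Fin n → ℝ}
    (hy : y ∈ closedBall x (2 * ε)) : |f y| ≤ 4 * M * ε ^ 2 := by
  have hε := hf.eps_pos
  have h := (convex_closedBall x (2 * ε)).norm_image_sub_le_of_norm_fderiv_le (𝕜 := ℝ)
    (f := f) (C := 2 * M * ε) (x := x) (y := y) (fun p hp =>
      (contDiffAt_of_posOrth hf.smooth (hf.ball_subset hp)).differentiableAt (by simp))
      (fun p hp => hf.norm_fderiv_le hp) (mem_closedBall_self (by linarith)) hy
  rw [hf.apply_eq, sub_zero, Real.norm_eq_abs] at h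
  rw [mem_closedBall_iff_norm] at hy
  have : 0 ≤ 2 * M * ε := by have := hf.M_nonneg; positivity
  nlinarith

theorem contDiffAt_cut (hχ : IsCutoff χ X) {m : WithTop ℕ∞} (hm : m ≤ ∞) {y : Fin n → ℝ}
    (hf : ContDiffAt ℝ m f y) : ContDiffAt ℝ m (cut χ x ε f) y :=
  ((contDiff_rescale (hχ.smooth.of_le hm) ε⁻¹ x).contDiffAt).mul hf

theorem cut_eventuallyEq_self (hχ : IsCutoff χ X) (hε : 0 < ε) {y : Fin n → ℝ}
    (hy : ‖y - x‖ < ε) : cut χ x ε f =ᶠ[𝓝 y] f := by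
  have : ∀ᶠ y' in 𝓝 y, ‖y' - x‖ < ε :=
    (isOpen_lt (by fun_prop : Continuous fun y : Fin n → ℝ => ‖y - x‖) continuous_const).mem_nhds hy
  filter_upwards [this] with y' hy'
  rw [cut, hχ.one _ (by rwa [norm_inv_smul_sub hε, div_lt_one hε]), one_mul]

theorem cut_eventuallyEq_zero (hχ : IsCutoff χ X) (hε : 0 < ε) {y : Fin n → ℝ}
    (hy : 2 * ε < ‖y - x‖) : cut χ x ε f =ᶠ[𝓝 y] fun _ => 0 := by
  have : ∀ᶠ y' in 𝓝 y, 2 * ε < ‖y' - x‖ :=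
    (isOpen_lt continuous_const (by fun_prop : Continuous fun y : Fin n → ℝ => ‖y - x‖)).mem_nhds hy
  filter_upwards [this] with y' hy'
  rw [cut, hχ.zero _ (by rw [norm_inv_smul_sub hε, le_div_iff₀ hε]; linarith), zero_mul]

theorem IsCutoff.X_nonneg (hχ : IsCutoff χ X) : 0 ≤ X :=
  (norm_nonneg _).trans (hχ.norm_fderiv_le 0)

theorem IsGerm.norm_fderiv_cut_le (hf : IsGerm f x ε M) (hχ : IsCutoff χ X) (y : Fin n → ℝ) :
    ‖fderiv ℝ (cut χ x ε f) y‖ ≤ (2 + 4 * X) * M * ε := by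
  have hε := hf.eps_pos
  have hM := hf.M_nonneg
  have hX := hχ.X_nonneg
  rcases lt_or_ge (2 * ε) ‖y - x‖ with h | h
  · rw [(cut_eventuallyEq_zero hχ hε h).fderiv_eq]
    simp only [fderiv_fun_const, Pi.zero_apply, norm_zero]; positivity
  have hy : y ∈ closedBall x (2 * ε) := mem_closedBall_iff_norm.2 h
  have hd := (contDiffAt_of_posOrth hf.smooth (hf.ball_subset hy)).differentiableAt (by simp)
  have hχ2 : ContDiff ℝ 2 χ := hχ.smooth.of_le (WithTop.coe_le_coe.2 (le_top : (2 : ℕ∞) ≤ ⊤))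
  have hd' : DifferentiableAt ℝ (fun y => χ (ε⁻¹ • (y - x))) y :=
    (contDiff_rescale hχ2 ε⁻¹ x).contDiffAt.differentiableAt (by simp)
  have e : fderiv ℝ (cut χ x ε f) y = _ := fderiv_fun_mul hd' hd
  rw [e, fderiv_rescale hχ2]
  have h1 := hf.norm_fderiv_le hy
  have h2 := hf.abs_le hy
  have h3 := hχ.norm_fderiv_le (ε⁻¹ • (y - x))
  have h4 := hχ.abs_le (ε⁻¹ • (y - x))
  calc _ ≤ |χ (ε⁻¹ • (y - x))| * ‖fderiv ℝ f y‖
        + |f y| * (ε⁻¹ * ‖fderiv ℝ χ (ε⁻¹ • (y - x))‖) := by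
        refine (norm_add_le _ _).trans_eq ?_
        rw [norm_smul, norm_smul, norm_smul, Real.norm_eq_abs, Real.norm_eq_abs,
          Real.norm_of_nonneg (inv_nonneg.2 hε.le)]
    _ ≤ 1 * (2 * M * ε) + 4 * M * ε ^ 2 * (ε⁻¹ * X) := by gcongr
    _ = _ := by field_simp

set_option maxSynthPendingDepth 3 in
theorem IsGerm.norm_d2_cut_le (hf : IsGerm f x ε M) (hχ : IsCutoff χ X) (y : Fin n → ℝ) :
    ‖d2 (cut χ x ε f) y‖ ≤ (1 + 8 * X) * M := by
  have hε := hf.eps_pos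
  have hM := hf.M_nonneg
  have hX := hχ.X_nonneg
  rcases lt_or_ge (2 * ε) ‖y - x‖ with h | h
  · have e : d2 (fun _ : Fin n → ℝ => (0:ℝ)) y = 0 := by simp [d2]
    rw [d2_congr (cut_eventuallyEq_zero hχ hε h), e, norm_zero]
    positivity
  have hy : y ∈ closedBall x (2 * ε) := mem_closedBall_iff_norm.2 h
  have hd : ContDiffAt ℝ 2 f y :=
    (contDiffAt_of_posOrth hf.smooth (hf.ball_subset hy)).of_le (by norm_num)
  have hχ2 : ContDiff ℝ 2 χ := hχ.smooth.of_le (WithTop.coe_le_coe.2 (le_top : (2 : ℕ∞) ≤ ⊤))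
  have hd' : ContDiffAt ℝ 2 (fun y => χ (ε⁻¹ • (y - x))) y :=
    (contDiff_rescale hχ2 ε⁻¹ x).contDiffAt
  have h1 := hf.norm_fderiv_le hy
  have h2 := hf.abs_le hy
  have h3 := hχ.norm_fderiv_le (ε⁻¹ • (y - x))
  have h4 := hχ.abs_le (ε⁻¹ • (y - x))
  have h5 := hf.norm_d2_le y hy
  have h6 := hχ.norm_d2_le (ε⁻¹ • (y - x))
  refine ContinuousLinearMap.opNorm_le_bound₂ _ (by positivity) fun v w => ?_
  have e : d2 (cut χ x ε f) y v w = _ := d2_mul hd' hd v w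
  rw [e, fderiv_rescale hχ2, d2_rescale hχ2]
  simp only [_root_.smul_apply, smul_eq_mul]
  have a1 := ContinuousLinearMap.le_of_opNorm_le _ (ContinuousLinearMap.le_of_opNorm_le _ h5 v) w
  have a2 := fun u => ContinuousLinearMap.le_of_opNorm_le _ h3 u
  have a3 := fun u => ContinuousLinearMap.le_of_opNorm_le _ h1 u
  have a4 := ContinuousLinearMap.le_of_opNorm_le _ (ContinuousLinearMap.le_of_opNorm_le _ h6 v) w
  rw [Real.norm_eq_abs]
  have a5 : |ε⁻¹| = ε⁻¹ := abs_of_pos (inv_pos.2 hε)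
  calc _ ≤ |χ (ε⁻¹ • (y - x))| * ‖d2 f y v w‖
        + ε⁻¹ * ‖fderiv ℝ χ (ε⁻¹ • (y - x)) v‖ * ‖fderiv ℝ f y w‖
        + |f y| * (ε⁻¹ * ε⁻¹ * ‖d2 χ (ε⁻¹ • (y - x)) v w‖)
        + ‖fderiv ℝ f y v‖ * (ε⁻¹ * ‖fderiv ℝ χ (ε⁻¹ • (y - x)) w‖) := by
        refine (abs_add_le _ _).trans (add_le_add ((abs_add_le _ _).trans (add_le_add
          ((abs_add_le _ _).trans (add_le_add ?_ ?_)) ?_)) ?_)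
        all_goals simp only [abs_mul, Real.norm_eq_abs, a5]; rfl
    _ ≤ 1 * (M * ‖v‖ * ‖w‖) + ε⁻¹ * (X * ‖v‖) * (2 * M * ε * ‖w‖)
        + 4 * M * ε ^ 2 * (ε⁻¹ * ε⁻¹ * (X * ‖v‖ * ‖w‖))
        + 2 * M * ε * ‖v‖ * (ε⁻¹ * (X * ‖w‖)) := by
        gcongr
        · exact a2 v
        · exact a3 w
        · exact a3 v
        · exact a2 w
    _ = _ := by field_simp; ring

end Cut

section Split

variable {n : ℕ} {f χ k : (Fin n → ℝ) → ℝ} {x y : Fin n → ℝ} {ε M X ρ C N : ℝ}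

/-- The compensator rescaled to the scale `ε` around `x`. -/
def scaledComp (k : (Fin n → ℝ) → ℝ) (x : Fin n → ℝ) (ε : ℝ) (y : Fin n → ℝ) : ℝ :=
  ε ^ 2 * k (ε⁻¹ • (y - x))

theorem IsCompensator.contDiff_two (hk : IsCompensator k ρ C) : ContDiff ℝ 2 k :=
  hk.smooth.of_le (WithTop.coe_le_coe.2 (le_top : (2 : ℕ∞) ≤ ⊤))

theorem IsCompensator.contDiff_scaledComp (hk : IsCompensator k ρ C) (x : Fin n → ℝ) (ε : ℝ) :
    ContDiff ℝ ∞ (scaledComp k x ε) :=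
  contDiff_const.mul (contDiff_rescale hk.smooth ε⁻¹ x)

theorem IsCompensator.fderiv_scaledComp (hk : IsCompensator k ρ C) (hε : 0 < ε)
    (y : Fin n → ℝ) :
    fderiv ℝ (scaledComp k x ε) y = ε • fderiv ℝ k (ε⁻¹ • (y - x)) := by
  have h : DifferentiableAt ℝ (fun y => k (ε⁻¹ • (y - x))) y :=
    (contDiff_rescale hk.contDiff_two ε⁻¹ x).contDiffAt.differentiableAt (by simp)
  have e : fderiv ℝ (scaledComp k x ε) y = _ := fderiv_const_mul h (ε ^ 2)
  rw [e, fderiv_rescale hk.contDiff_two, smul_smul]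
  congr 1; field_simp

theorem IsCompensator.d2_scaledComp (hk : IsCompensator k ρ C) (hε : 0 < ε)
    (y : Fin n → ℝ) :
    d2 (scaledComp k x ε) y = d2 k (ε⁻¹ • (y - x)) := by
  have h : TwiceDiffAt (fun y => k (ε⁻¹ • (y - x))) y :=
    (contDiff_rescale hk.contDiff_two ε⁻¹ x).contDiffAt.twiceDiffAt
  have e : d2 (scaledComp k x ε) y = _ := d2_const_smul h (ε ^ 2)
  rw [e, d2_rescale hk.contDiff_two, smul_smul]
  have : ε ^ 2 * (ε⁻¹ * ε⁻¹) = 1 := by field_simp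
  rw [this, one_smul]

theorem IsCompensator.scaledComp_eventuallyEq_zero (hk : IsCompensator k ρ C) (hε : 0 < ε) :
    scaledComp k x ε =ᶠ[𝓝 x] fun _ => 0 := by
  filter_upwards [ball_mem_nhds x (mul_pos hk.rho_pos hε)] with y hy
  rw [scaledComp, hk.flat, mul_zero]
  rwa [norm_inv_smul_sub hε, div_lt_iff₀ hε, ← mem_ball_iff_norm]

/-- The constant in front of the compensator. -/
def compConst (M X : ℝ) : ℝ := 25 * ((1 + 8 * X) * M)

/-- The localized part of `f`, made convex by the compensator. -/
def localPart (k χ : (Fin n → ℝ) → ℝ) (x : Fin n → ℝ) (ε N : ℝ) (f : (Fin n → ℝ) → ℝ)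
    (y : Fin n → ℝ) : ℝ :=
  cut χ x ε f y + N • scaledComp k x ε y

/-- The part of `f` away from `x`, made convex by the compensator. -/
def farPart (k χ : (Fin n → ℝ) → ℝ) (x : Fin n → ℝ) (ε N : ℝ) (f : (Fin n → ℝ) → ℝ)
    (y : Fin n → ℝ) : ℝ :=
  (f y - cut χ x ε f y) + N • scaledComp k x ε y

section Basic

variable (hf : ContDiffOn ℝ 4 f (posOrth n)) (hχ : IsCutoff χ X) (hk : IsCompensator k ρ C)
include hf hχ hk

omit hk in
theorem contDiffOn_cut : ContDiffOn ℝ 4 (cut χ x ε f) (posOrth n) := fun _ hy =>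
  (contDiffAt_cut hχ (WithTop.coe_le_coe.2 (le_top : (4 : ℕ∞) ≤ ⊤))
    (contDiffAt_of_posOrth hf hy)).contDiffWithinAt

theorem contDiffOn_localPart : ContDiffOn ℝ 4 (localPart k χ x ε N f) (posOrth n) :=
  (contDiffOn_cut hf hχ).add (((hk.contDiff_scaledComp x ε).of_le
    (WithTop.coe_le_coe.2 (le_top : (4 : ℕ∞) ≤ ⊤))).const_smul N).contDiffOn

theorem contDiffOn_farPart : ContDiffOn ℝ 4 (farPart k χ x ε N f) (posOrth n) :=
  (hf.sub (contDiffOn_cut hf hχ)).add (((hk.contDiff_scaledComp x ε).of_le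
    (WithTop.coe_le_coe.2 (le_top : (4 : ℕ∞) ≤ ⊤))).const_smul N).contDiffOn

theorem d2_localPart (hε : 0 < ε) (hy : y ∈ posOrth n) :
    d2 (localPart k χ x ε N f) y = d2 (cut χ x ε f) y + N • d2 k (ε⁻¹ • (y - x)) := by
  have h1 : TwiceDiffAt (cut χ x ε f) y :=
    ((contDiffAt_of_posOrth (contDiffOn_cut hf hχ) hy).of_le (by norm_num)).twiceDiffAt
  have h2 : TwiceDiffAt (scaledComp k x ε) y :=
    (hk.contDiff_scaledComp x ε).contDiffAt.of_le
      (WithTop.coe_le_coe.2 (le_top : (2 : ℕ∞) ≤ ⊤)) |>.twiceDiffAt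
  rw [← hk.d2_scaledComp hε, ← d2_const_smul h2]
  exact d2_add h1 (h2.const_smul N)

theorem d2_farPart (hε : 0 < ε) (hy : y ∈ posOrth n) :
    d2 (farPart k χ x ε N f) y
      = (d2 f y - d2 (cut χ x ε f) y) + N • d2 k (ε⁻¹ • (y - x)) := by
  have h0 : TwiceDiffAt f y :=
    ((contDiffAt_of_posOrth hf hy).of_le (by norm_num)).twiceDiffAt
  have h1 : TwiceDiffAt (cut χ x ε f) y :=
    ((contDiffAt_of_posOrth (contDiffOn_cut hf hχ) hy).of_le (by norm_num)).twiceDiffAt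
  have h1' : TwiceDiffAt (fun y => f y - cut χ x ε f y) y :=
    (((contDiffAt_of_posOrth hf hy).sub
      (contDiffAt_of_posOrth (contDiffOn_cut hf hχ) hy)).of_le (by norm_num)).twiceDiffAt
  have h2 : TwiceDiffAt (scaledComp k x ε) y :=
    (hk.contDiff_scaledComp x ε).contDiffAt.of_le
      (WithTop.coe_le_coe.2 (le_top : (2 : ℕ∞) ≤ ⊤)) |>.twiceDiffAt
  rw [← hk.d2_scaledComp hε, ← d2_const_smul h2, ← d2_sub h0 h1]
  exact d2_add h1' (h2.const_smul N)

theorem fderiv_localPart (hε : 0 < ε) (hy : y ∈ posOrth n) :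
    fderiv ℝ (localPart k χ x ε N f) y
      = fderiv ℝ (cut χ x ε f) y + N • ε • fderiv ℝ k (ε⁻¹ • (y - x)) := by
  have h1 : DifferentiableAt ℝ (cut χ x ε f) y :=
    (contDiffAt_of_posOrth (contDiffOn_cut hf hχ) hy).differentiableAt (by simp)
  have h2 : DifferentiableAt ℝ (scaledComp k x ε) y :=
    (hk.contDiff_scaledComp x ε).contDiffAt.differentiableAt (by simp)
  rw [← hk.fderiv_scaledComp hε, ← fderiv_fun_const_smul h2]
  exact fderiv_fun_add h1 (h2.const_smul N)

theorem fderiv_farPart (hε : 0 < ε) (hy : y ∈ posOrth n) :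
    fderiv ℝ (farPart k χ x ε N f) y
      = (fderiv ℝ f y - fderiv ℝ (cut χ x ε f) y) + N • ε • fderiv ℝ k (ε⁻¹ • (y - x)) := by
  have h0 : DifferentiableAt ℝ f y := (contDiffAt_of_posOrth hf hy).differentiableAt (by simp)
  have h1 : DifferentiableAt ℝ (cut χ x ε f) y :=
    (contDiffAt_of_posOrth (contDiffOn_cut hf hχ) hy).differentiableAt (by simp)
  have h2 : DifferentiableAt ℝ (scaledComp k x ε) y :=
    (hk.contDiff_scaledComp x ε).contDiffAt.differentiableAt (by simp)
  rw [← hk.fderiv_scaledComp hε, ← fderiv_fun_const_smul h2, ← fderiv_fun_sub h0 h1]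
  exact fderiv_fun_add (h0.sub h1) (h2.const_smul N)

omit hf in
theorem localPart_eventuallyEq (hε : 0 < ε) : localPart k χ x ε N f =ᶠ[𝓝 x] f := by
  filter_upwards [hk.scaledComp_eventuallyEq_zero (x := x) hε,
    cut_eventuallyEq_self (f := f) hχ hε (x := x) (y := x) (by simpa using hε)] with y h1 h2
  rw [localPart, h1, h2]; simp

omit hf in
theorem farPart_eventuallyEq (hε : 0 < ε) : farPart k χ x ε N f =ᶠ[𝓝 x] fun _ => 0 := by
  filter_upwards [hk.scaledComp_eventuallyEq_zero (x := x) hε,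
    cut_eventuallyEq_self (f := f) hχ hε (x := x) (y := x) (by simpa using hε)] with y h1 h2
  rw [farPart, h1, h2]; simp

end Basic

section Germ

variable (hf : IsGerm f x ε M) (hχ : IsCutoff χ X) (hk : IsCompensator k ρ C)
include hf hχ hk

omit hk in
theorem compConst_nonneg : 0 ≤ compConst M X := by
  have := hf.M_nonneg
  have := hχ.X_nonneg
  unfold compConst; positivity

theorem compConst_mul_d2_nonneg (Y v : Fin n → ℝ) : 0 ≤ compConst M X * d2 k Y v v :=
  mul_nonneg (compConst_nonneg hf hχ) (hk.d2_nonneg Y v)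

theorem abs_d2_cut_le (h1 : ε ≤ ‖y - x‖) (h2 : ‖y - x‖ ≤ 2 * ε) (v : Fin n → ℝ) :
    |d2 (cut χ x ε f) y v v| ≤ compConst M X * d2 k (ε⁻¹ • (y - x)) v v := by
  have hε := hf.eps_pos
  have hM := hf.M_nonneg
  have hX := hχ.X_nonneg
  have a1 := ContinuousLinearMap.le_of_opNorm_le _
    (ContinuousLinearMap.le_of_opNorm_le _ (hf.norm_d2_cut_le hχ y) v) v
  have a2 := hk.d2_ge (ε⁻¹ • (y - x)) (by rwa [norm_inv_smul_sub hε, le_div_iff₀ hε, one_mul])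
    (by rwa [norm_inv_smul_sub hε, div_le_iff₀ hε]) v
  rw [Real.norm_eq_abs] at a1
  calc _ ≤ (1 + 8 * X) * M * ‖v‖ * ‖v‖ := a1
    _ = (1 + 8 * X) * M * ‖v‖ ^ 2 := by ring
    _ ≤ (1 + 8 * X) * M * (25 * d2 k (ε⁻¹ • (y - x)) v v) := by gcongr
    _ = _ := by rw [compConst]; ring

theorem d2_localPart_nonneg (hy : y ∈ posOrth n) (v : Fin n → ℝ) :
    0 ≤ d2 (localPart k χ x ε (compConst M X) f) y v v := by
  have hε := hf.eps_pos
  have hc := compConst_mul_d2_nonneg hf hχ hk (ε⁻¹ • (y - x)) v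
  rw [d2_localPart hf.smooth hχ hk hε hy]
  simp only [_root_.add_apply, _root_.smul_apply, smul_eq_mul]
  rcases lt_or_ge ‖y - x‖ ε with h1 | h1
  · rw [d2_congr (cut_eventuallyEq_self hχ hε h1)]
    linarith [hf.d2_nonneg y hy v]
  rcases lt_or_ge (2 * ε) ‖y - x‖ with h2 | h2
  · have e : d2 (fun _ : Fin n → ℝ => (0:ℝ)) y = 0 := by simp [d2]
    rw [d2_congr (cut_eventuallyEq_zero hχ hε h2), e]
    simpa using hc
  · linarith [neg_abs_le (d2 (cut χ x ε f) y v v), abs_d2_cut_le hf hχ hk h1 h2 v]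

theorem d2_farPart_nonneg (hy : y ∈ posOrth n) (v : Fin n → ℝ) :
    0 ≤ d2 (farPart k χ x ε (compConst M X) f) y v v := by
  have hε := hf.eps_pos
  have hc := compConst_mul_d2_nonneg hf hχ hk (ε⁻¹ • (y - x)) v
  have h0 := hf.d2_nonneg y hy v
  rw [d2_farPart hf.smooth hχ hk hε hy]
  simp only [_root_.add_apply, _root_.smul_apply, _root_.sub_apply, smul_eq_mul]
  rcases lt_or_ge ‖y - x‖ ε with h1 | h1
  · rw [d2_congr (cut_eventuallyEq_self hχ hε h1)]
    linarith
  rcases lt_or_ge (2 * ε) ‖y - x‖ with h2 | h2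
  · have e : d2 (fun _ : Fin n → ℝ => (0:ℝ)) y = 0 := by simp [d2]
    rw [d2_congr (cut_eventuallyEq_zero hχ hε h2), e]
    simp only [_root_.zero_apply]
    linarith
  · linarith [le_abs_self (d2 (cut χ x ε f) y v v), abs_d2_cut_le hf hχ hk h1 h2 v]

theorem convexOn_localPart :
    ConvexOn ℝ (posOrth n) (localPart k χ x ε (compConst M X) f) :=
  convexOn_of_d2_nonneg (isOpen_posOrth n) (convex_posOrth n)
    ((contDiffOn_localPart hf.smooth hχ hk).of_le (by norm_num))
    fun _ hy v => d2_localPart_nonneg hf hχ hk hy v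

theorem convexOn_farPart :
    ConvexOn ℝ (posOrth n) (farPart k χ x ε (compConst M X) f) :=
  convexOn_of_d2_nonneg (isOpen_posOrth n) (convex_posOrth n)
    ((contDiffOn_farPart hf.smooth hχ hk).of_le (by norm_num))
    fun _ hy v => d2_farPart_nonneg hf hχ hk hy v

set_option maxSynthPendingDepth 3 in
theorem norm_d2_localPart_le (hy : y ∈ posOrth n) :
    ‖d2 (localPart k χ x ε (compConst M X) f) y‖ ≤ (1 + 8 * X) * M + compConst M X * C := by
  have hN := compConst_nonneg hf hχ
  rw [d2_localPart hf.smooth hχ hk hf.eps_pos hy]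
  refine (norm_add_le _ _).trans (add_le_add (hf.norm_d2_cut_le hχ y) ?_)
  rw [norm_smul, Real.norm_of_nonneg hN]
  exact mul_le_mul_of_nonneg_left (hk.norm_d2_le _) hN

set_option maxSynthPendingDepth 3 in
theorem norm_d2_farPart_le (hy : y ∈ posOrth n) :
    ‖d2 (farPart k χ x ε (compConst M X) f) y‖
      ≤ ‖d2 f y‖ + (1 + 8 * X) * M + compConst M X * C := by
  have hN := compConst_nonneg hf hχ
  rw [d2_farPart hf.smooth hχ hk hf.eps_pos hy]
  refine (norm_add_le _ _).trans (add_le_add ((norm_sub_le _ _).trans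
    (add_le_add le_rfl (hf.norm_d2_cut_le hχ y))) ?_)
  rw [norm_smul, Real.norm_of_nonneg hN]
  exact mul_le_mul_of_nonneg_left (hk.norm_d2_le _) hN

theorem norm_fderiv_localPart_le (hy : y ∈ posOrth n) :
    ‖fderiv ℝ (localPart k χ x ε (compConst M X) f) y‖
      ≤ ((2 + 4 * X) * M + compConst M X * C) * ε := by
  have hN := compConst_nonneg hf hχ
  have hε := hf.eps_pos
  rw [fderiv_localPart hf.smooth hχ hk hf.eps_pos hy, add_mul]
  refine (norm_add_le _ _).trans (add_le_add (hf.norm_fderiv_cut_le hχ y) ?_)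
  rw [norm_smul, norm_smul, Real.norm_of_nonneg hN, Real.norm_of_nonneg hε.le]
  have := hk.norm_fderiv_le (ε⁻¹ • (y - x))
  calc _ ≤ compConst M X * (ε * C) := by gcongr
    _ = _ := by ring

theorem norm_fderiv_farPart_sub_le (hy : y ∈ posOrth n) :
    ‖fderiv ℝ (farPart k χ x ε (compConst M X) f) y - fderiv ℝ f y‖
      ≤ ((2 + 4 * X) * M + compConst M X * C) * ε := by
  have hN := compConst_nonneg hf hχ
  have hε := hf.eps_pos
  rw [fderiv_farPart hf.smooth hχ hk hf.eps_pos hy, add_mul]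
  have e : fderiv ℝ f y - fderiv ℝ (cut χ x ε f) y
      + compConst M X • ε • fderiv ℝ k (ε⁻¹ • (y - x)) - fderiv ℝ f y
      = compConst M X • ε • fderiv ℝ k (ε⁻¹ • (y - x)) - fderiv ℝ (cut χ x ε f) y := by abel
  rw [e, add_comm ((2 + 4 * X) * M * ε)]
  refine (norm_sub_le _ _).trans (add_le_add ?_ (hf.norm_fderiv_cut_le hχ y))
  rw [norm_smul, norm_smul, Real.norm_of_nonneg hN, Real.norm_of_nonneg hε.le]
  have := hk.norm_fderiv_le (ε⁻¹ • (y - x))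
  calc _ ≤ compConst M X * (ε * C) := by gcongr
    _ = _ := by ring

end Germ

theorem eventually_d2_cut_eq_zero (hχ : IsCutoff χ X) (F : ℝ → (Fin n → ℝ) → ℝ) (hy : y ≠ x) :
    ∀ᶠ ε in 𝓝[>] (0:ℝ), d2 (cut χ x ε (F ε)) y = 0 := by
  have h : 0 < ‖y - x‖ / 2 := by have := norm_sub_pos_iff.2 hy; positivity
  filter_upwards [Ioo_mem_nhdsGT h] with ε hε
  have e : d2 (fun _ : Fin n → ℝ => (0:ℝ)) y = 0 := by simp [d2]
  rw [d2_congr (cut_eventuallyEq_zero hχ hε.1 (by linarith [hε.2])), e]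

end Split

section LocHolder

/-- The `k`-th derivative of `g` is `α`-Hölder in a neighbourhood of `x`. -/
def LocHolder {E F : Type} [NormedAddCommGroup E] [NormedSpace ℝ E] [NormedAddCommGroup F]
    [NormedSpace ℝ F] (α : ℝ≥0) (k : ℕ) (g : E → F) (x : E) : Prop :=
  ∃ s ∈ 𝓝 x, ∃ C : ℝ≥0, HolderOnWith C α (iteratedFDeriv ℝ k g) s

variable {E F G H : Type} [NormedAddCommGroup E] [NormedSpace ℝ E] [NormedAddCommGroup F]
  [NormedSpace ℝ F] [NormedAddCommGroup G] [NormedSpace ℝ G] [NormedAddCommGroup H]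
  [NormedSpace ℝ H] {α : ℝ≥0} {k : ℕ} {x : E}

omit [NormedSpace ℝ E] [NormedSpace ℝ F] in
theorem holderOnWith_iff_norm {C α : ℝ≥0} {f : E → F} {s : Set E} :
    HolderOnWith C α f s ↔ ∀ p ∈ s, ∀ q ∈ s, ‖f p - f q‖ ≤ C * ‖p - q‖ ^ (α : ℝ) := by
  refine forall₄_congr fun p _ q _ => ?_
  rw [edist_nndist, edist_nndist, ← ENNReal.coe_rpow_of_nonneg _ α.coe_nonneg, ← ENNReal.coe_mul,
    ENNReal.coe_le_coe, ← NNReal.coe_le_coe, coe_nndist, NNReal.coe_mul, NNReal.coe_rpow,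
    coe_nndist, dist_eq_norm, dist_eq_norm]

theorem LocHolder.congr {f g : E → F} (h : f =ᶠ[𝓝 x] g) (hg : LocHolder α k g x) :
    LocHolder α k f x := by
  obtain ⟨s, hs, C, hC⟩ := hg
  refine ⟨_, inter_mem hs (h.iteratedFDeriv ℝ k), C, fun p hp q hq => ?_⟩
  have h1 : iteratedFDeriv ℝ k f p = _ := hp.2
  have h2 : iteratedFDeriv ℝ k f q = _ := hq.2
  rw [h1, h2]
  exact hC p hp.1 q hq.1

theorem locHolder_zero {g : E → F} :
    LocHolder α 0 g x ↔ ∃ s ∈ 𝓝 x, ∃ C : ℝ≥0, HolderOnWith C α g s := by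
  refine exists_congr fun s => and_congr_right fun _ => exists_congr fun C =>
    forall₄_congr fun p _ q _ => ?_
  rw [iteratedFDeriv_zero_eq_comp, Function.comp_apply, Function.comp_apply,
    LinearIsometryEquiv.edist_map]

theorem locHolder_succ {g : E → F} :
    LocHolder α (k + 1) g x ↔ LocHolder α k (fderiv ℝ g) x := by
  refine exists_congr fun s => and_congr_right fun _ => exists_congr fun C =>
    forall₄_congr fun p _ q _ => ?_
  rw [iteratedFDeriv_succ_eq_comp_right, iteratedFDeriv_succ_eq_comp_right, Function.comp_apply,
    Function.comp_apply, LinearIsometryEquiv.edist_map]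

theorem LocHolder.add {f g : E → F} (hf : LocHolder α k f x) (hg : LocHolder α k g x)
    (cf : ContDiffAt ℝ k f x) (cg : ContDiffAt ℝ k g x) :
    LocHolder α k (fun y => f y + g y) x := by
  obtain ⟨s, hs, C, hC⟩ := hf
  obtain ⟨t, ht, D, hD⟩ := hg
  refine ⟨_, inter_mem (inter_mem hs ht)
    (inter_mem (cf.eventually (by simp)) (cg.eventually (by simp))), C + D, ?_⟩
  rw [holderOnWith_iff_norm] at *
  intro p hp q hq
  have e : ∀ p, ContDiffAt ℝ k f p → ContDiffAt ℝ k g p →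
      iteratedFDeriv ℝ k (fun y => f y + g y) p = iteratedFDeriv ℝ k f p + iteratedFDeriv ℝ k g p :=
    fun p h1 h2 => iteratedFDeriv_add_apply h1 h2
  rw [e p hp.2.1 hp.2.2, e q hq.2.1 hq.2.2, add_sub_add_comm, NNReal.coe_add, add_mul]
  exact (norm_add_le _ _).trans (add_le_add (hC p hp.1.1 q hq.1.1) (hD p hp.1.2 q hq.1.2))

theorem ContDiffAt.exists_holderOnWith {f : E → F} (hα : α ≤ 1) (h : ContDiffAt ℝ 1 f x) :
    ∃ s ∈ 𝓝 x, ∃ C : ℝ≥0, HolderOnWith C α f s := by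
  obtain ⟨K, t, ht, hK⟩ := h.exists_lipschitzOnWith
  refine ⟨t ∩ ball x 1, inter_mem ht (ball_mem_nhds x one_pos), _,
    HolderOnWith.of_le (D := 2) (r := 1) (fun p hp q hq => ?_)
    (holderOnWith_one.2 (hK.mono inter_subset_left)) hα⟩
  rw [edist_nndist, ENNReal.coe_le_coe, ← NNReal.coe_le_coe, coe_nndist]
  have h1 := dist_triangle_right p q x
  have h2 := mem_ball.1 hp.2
  have h3 := mem_ball.1 hq.2
  push_cast
  linarith

theorem ContDiffAt.locHolder {f : E → F} (hα : α ≤ 1) (h : ContDiffAt ℝ (k + 1 : ℕ) f x) :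
    LocHolder α k f x :=
  ContDiffAt.exists_holderOnWith hα (h.iteratedFDeriv_right (by push_cast; rw [add_comm]))

theorem LocHolder.comp_add_right {f : E → F} {a : E} (h : LocHolder α k f (x + a)) :
    LocHolder α k (fun y => f (y + a)) x := by
  obtain ⟨s, hs, C, hC⟩ := h
  refine ⟨(fun y => y + a) ⁻¹' s, (by fun_prop : Continuous fun y : E => y + a).continuousAt hs,
    C, fun p hp q hq => ?_⟩
  rw [iteratedFDeriv_comp_add_right, iteratedFDeriv_comp_add_right]
  simpa using hC _ hp _ hq

set_option maxSynthPendingDepth 3 in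
theorem LocHolder.bilinear (hα : α ≤ 1) (k : ℕ) : ∀ {F G H : Type} [NormedAddCommGroup F]
    [NormedSpace ℝ F] [NormedAddCommGroup G] [NormedSpace ℝ G] [NormedAddCommGroup H]
    [NormedSpace ℝ H] (B : F →L[ℝ] G →L[ℝ] H) {a : E → F} {f : E → G},
    ContDiffAt ℝ (k + 1 : ℕ) a x → ContDiffAt ℝ k f x → LocHolder α k f x →
    LocHolder α k (fun y => B (a y) (f y)) x := by
  induction k with
  | zero =>
    intro F G H _ _ _ _ _ _ B a f ha hf h
    rw [locHolder_zero] at h ⊢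
    have ha1 : ContDiffAt ℝ 1 a x := by simpa using ha
    obtain ⟨s, hs, C, hC⟩ := h
    obtain ⟨t, ht, D, hD⟩ := ha1.exists_holderOnWith hα
    have b1 : ∀ᶠ y in 𝓝 x, ‖a y‖ < ‖a x‖ + 1 :=
      ha1.continuousAt.norm.eventually_lt continuousAt_const (by simp)
    have b2 : ∀ᶠ y in 𝓝 x, ‖f y‖ < ‖f x‖ + 1 :=
      hf.continuousAt.norm.eventually_lt continuousAt_const (by simp)
    refine ⟨_, inter_mem (inter_mem hs ht) (inter_mem b1 b2),
      ‖B‖₊ * (D * (‖f x‖₊ + 1) + (‖a x‖₊ + 1) * C), ?_⟩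
    rw [holderOnWith_iff_norm] at *
    intro p hp q hq
    have e : B (a p) (f p) - B (a q) (f q) = B (a p - a q) (f p) + B (a q) (f p - f q) := by
      simp
    have c1 := B.le_opNorm₂ (a p - a q) (f p)
    have c2 := B.le_opNorm₂ (a q) (f p - f q)
    have c3 := hC p hp.1.1 q hq.1.1
    have c4 := hD p hp.1.2 q hq.1.2
    have c5 : ‖f p‖ ≤ ‖f x‖ + 1 := le_of_lt hp.2.2
    have c6 : ‖a q‖ ≤ ‖a x‖ + 1 := le_of_lt hq.2.1
    rw [e]
    push_cast
    calc _ ≤ ‖B‖ * ‖a p - a q‖ * ‖f p‖ + ‖B‖ * ‖a q‖ * ‖f p - f q‖ :=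
          (norm_add_le _ _).trans (add_le_add c1 c2)
      _ ≤ ‖B‖ * (D * ‖p - q‖ ^ (α : ℝ)) * (‖f x‖ + 1)
          + ‖B‖ * (‖a x‖ + 1) * (C * ‖p - q‖ ^ (α : ℝ)) := by gcongr
      _ = _ := by ring
  | succ k ih =>
    intro F G H _ _ _ _ _ _ B a f ha hf h
    rw [locHolder_succ] at h ⊢
    have da : ContDiffAt ℝ (k + 1 : ℕ) (fderiv ℝ a) x := ha.fderiv_right (by push_cast; rfl)
    have df : ContDiffAt ℝ k (fderiv ℝ f) x := hf.fderiv_right (by push_cast; rfl)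
    have ha' : ContDiffAt ℝ (k + 1 : ℕ) a x := ha.of_le (by norm_cast; omega)
    have hf' : ContDiffAt ℝ k f x := hf.of_le (by norm_cast; omega)
    have e : fderiv ℝ (fun y => B (a y) (f y)) =ᶠ[𝓝 x] fun y =>
        B.precompR E (a y) (fderiv ℝ f y) + B.precompL E (fderiv ℝ a y) (f y) := by
      filter_upwards [ha.eventually (by simp), hf.eventually (by simp)] with y h1 h2
      exact B.fderiv_of_bilinear (h1.differentiableAt (by simp)) (h2.differentiableAt (by simp))
    refine LocHolder.congr e (LocHolder.add (ih _ ha' df h)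
      (ih (B.precompL E) da hf' (hf.locHolder hα)) ?_ ?_)
    · exact (B.precompR E).isBoundedBilinearMap.contDiff.contDiffAt.comp₂ (ha'.of_le (by simp)) df
    · exact (B.precompL E).isBoundedBilinearMap.contDiff.contDiffAt.comp₂ (da.of_le (by simp)) hf'

end LocHolder

section Growth

variable {n : ℕ} {f g : (Fin n → ℝ) → ℝ}

/-- The two-jet of `f` grows at most polynomially on the orthant, up to its boundary. -/
def PolyBdd (f : (Fin n → ℝ) → ℝ) : Prop :=
  ∃ (C : ℝ) (N : ℕ), 0 ≤ C ∧ ∀ y ∈ posOrth n, ∀ j : ℕ, j ≤ 2 →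
    ‖iteratedFDeriv ℝ j f y‖ ≤ C * (1 + ‖y‖) ^ N

theorem PolyBdd.add (hf : PolyBdd f) (hg : PolyBdd g) (cf : ContDiffOn ℝ 2 f (posOrth n))
    (cg : ContDiffOn ℝ 2 g (posOrth n)) : PolyBdd (fun y => f y + g y) := by
  obtain ⟨C, N, hC, h1⟩ := hf
  obtain ⟨D, M, hD, h2⟩ := hg
  refine ⟨C + D, max N M, add_nonneg hC hD, fun y hy j hj => ?_⟩
  have hj' : (j : WithTop ℕ∞) ≤ 2 := by exact_mod_cast hj
  have e : iteratedFDeriv ℝ j (fun y => f y + g y) y = _ :=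
    iteratedFDeriv_add_apply ((contDiffAt_of_posOrth cf hy).of_le hj')
      ((contDiffAt_of_posOrth cg hy).of_le hj')
  have hy1 : 1 ≤ 1 + ‖y‖ := by simp
  rw [e, add_mul]
  refine (norm_add_le _ _).trans (add_le_add ((h1 y hy j hj).trans ?_) ((h2 y hy j hj).trans ?_))
  · gcongr
    exact le_max_left _ _
  · gcongr
    exact le_max_right _ _

theorem PolyBdd.polyGrowth (hf : PolyBdd f) :
    ∃ C m : ℝ, ∀ x ∈ posOrth n, ∀ k : ℕ, k ≤ 2 →
      ‖iteratedFDeriv ℝ k f x‖ ≤ C * (1 + ‖x‖ ^ m) := by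
  obtain ⟨C, N, hC, h⟩ := hf
  refine ⟨C * 2 ^ (N - 1), N, fun x hx k hk => (h x hx k hk).trans ?_⟩
  rw [Real.rpow_natCast, mul_assoc]
  have := add_pow_le zero_le_one (norm_nonneg x) N
  rw [one_pow] at this
  gcongr

theorem norm_iteratedFDeriv_two_eq (f : (Fin n → ℝ) → ℝ) (y : Fin n → ℝ) :
    ‖iteratedFDeriv ℝ 2 f y‖ = ‖d2 f y‖ := by
  rw [← norm_iteratedFDeriv_fderiv, norm_iteratedFDeriv_one]; rfl

set_option maxSynthPendingDepth 3 in
theorem polyBdd_of_norm_d2_le (hf : ContDiffOn ℝ 2 f (posOrth n)) {M : ℝ}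
    (h : ∀ y ∈ posOrth n, ‖d2 f y‖ ≤ M) {x : Fin n → ℝ} (hx : x ∈ posOrth n) : PolyBdd f := by
  have hM : 0 ≤ M := (norm_nonneg _).trans (h x hx)
  set R := 1 + ‖x‖ with hR
  have hR1 : 1 ≤ R := by simp [hR]
  set A := ‖fderiv ℝ f x‖ + M * R with hA
  have hA0 : 0 ≤ A := by positivity
  have hd : ∀ y ∈ posOrth n, ‖fderiv ℝ f y‖ ≤ A * (1 + ‖y‖) := by
    intro y hy
    have h1 := (convex_posOrth n).norm_image_sub_le_of_norm_fderiv_le (𝕜 := ℝ)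
      (f := fderiv ℝ f) (fun p hp => (contDiffAt_of_posOrth hf hp).twiceDiffAt.2) h hx hy
    have h2 := norm_sub_norm_le (fderiv ℝ f y) (fderiv ℝ f x)
    have h3 : ‖y - x‖ ≤ R * (1 + ‖y‖) := by
      have := norm_sub_le y x
      nlinarith [norm_nonneg x, norm_nonneg y, mul_nonneg (norm_nonneg x) (norm_nonneg y)]
    have h4 : M * ‖y - x‖ ≤ M * (R * (1 + ‖y‖)) := by gcongr
    nlinarith [norm_nonneg (fderiv ℝ f x), norm_nonneg y,
      mul_nonneg (norm_nonneg (fderiv ℝ f x)) (norm_nonneg y)]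
  have h0 : ∀ y ∈ posOrth n, ‖f y‖ ≤ ‖f x‖ + A * (R * (1 + ‖y‖)) * (R * (1 + ‖y‖)) := by
    intro y hy
    have hsub : segment ℝ x y ⊆ posOrth n := (convex_posOrth n).segment_subset hx hy
    have hxy : ‖x‖ + ‖y‖ + 1 ≤ R * (1 + ‖y‖) := by
      nlinarith [mul_nonneg (norm_nonneg x) (norm_nonneg y)]
    have hp : ∀ p ∈ segment ℝ x y, ‖fderiv ℝ f p‖ ≤ A * (R * (1 + ‖y‖)) := by
      intro p hp
      refine (hd p (hsub hp)).trans ?_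
      have hpn : ‖p‖ ≤ ‖x‖ + ‖y‖ := by
        obtain ⟨a, b, ha, hb, hab, rfl⟩ := hp
        refine (norm_add_le _ _).trans ?_
        rw [norm_smul, norm_smul, Real.norm_of_nonneg ha, Real.norm_of_nonneg hb]
        nlinarith [norm_nonneg x, norm_nonneg y]
      gcongr
      linarith
    have h1 := (convex_segment x y).norm_image_sub_le_of_norm_fderiv_le (𝕜 := ℝ)
      (f := f) (fun p hp => (contDiffAt_of_posOrth hf (hsub hp)).differentiableAt (by simp)) hp
      (left_mem_segment ℝ x y) (right_mem_segment ℝ x y)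
    have h2 := norm_sub_norm_le (f y) (f x)
    have h3 : ‖y - x‖ ≤ R * (1 + ‖y‖) := by linarith [norm_sub_le y x]
    have h4 : A * (R * (1 + ‖y‖)) * ‖y - x‖ ≤ A * (R * (1 + ‖y‖)) * (R * (1 + ‖y‖)) := by gcongr
    linarith
  refine ⟨M + A + ‖f x‖ + A * R ^ 2, 2, by positivity, fun y hy j hj => ?_⟩
  have hs : 1 + ‖y‖ ≤ (1 + ‖y‖) ^ 2 := by nlinarith [norm_nonneg y]
  have hs1 : 1 ≤ (1 + ‖y‖) ^ 2 := by nlinarith [norm_nonneg y]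
  have t1 : M * 1 ≤ M * (1 + ‖y‖) ^ 2 := by gcongr
  have t2 : A * (1 + ‖y‖) ≤ A * (1 + ‖y‖) ^ 2 := by gcongr
  have t3 : ‖f x‖ * 1 ≤ ‖f x‖ * (1 + ‖y‖) ^ 2 := by gcongr
  have t4 : 0 ≤ A * R ^ 2 * (1 + ‖y‖) ^ 2 := by positivity
  have t5 : 0 ≤ M * (1 + ‖y‖) ^ 2 := by positivity
  have t6 : 0 ≤ A * (1 + ‖y‖) ^ 2 := by positivity
  have t7 : 0 ≤ ‖f x‖ * (1 + ‖y‖) ^ 2 := by positivity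
  interval_cases j
  · rw [norm_iteratedFDeriv_zero]; linarith [h0 y hy]
  · rw [norm_iteratedFDeriv_one]; linarith [hd y hy]
  · rw [norm_iteratedFDeriv_two_eq]; linarith [h y hy]

/-- The vector with all entries equal to `δ`. -/
def diagVec (n : ℕ) (δ : ℝ) : Fin n → ℝ := fun _ => δ

theorem add_diagVec_mem {δ : ℝ} (hδ : 0 ≤ δ) {y : Fin n → ℝ} (hy : y ∈ posOrth n) :
    y + diagVec n δ ∈ posOrth n := fun i => add_pos_of_pos_of_nonneg (hy i) hδ

theorem MemTestClass.polyBdd_comp_add (hf : MemTestClass n f) (hn : 0 < n) {δ : ℝ} (hδ : 0 < δ) :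
    PolyBdd (fun y => f (y + diagVec n δ)) := by
  obtain ⟨C, m, h⟩ := hf.polyGrowth
  set N := ⌈|m|⌉₊ with hN
  have hmN : |m| ≤ N := Nat.le_ceil _
  refine ⟨|C| * ((2 + δ ^ m) * (1 + δ) ^ N), N, by positivity, fun y hy j hj => ?_⟩
  rw [iteratedFDeriv_comp_add_right]
  refine (h _ (add_diagVec_mem hδ.le hy) j hj).trans ?_
  set r := ‖y + diagVec n δ‖ with hr
  have hr1 : δ ≤ r := by
    have h1 := norm_le_pi_norm (y + diagVec n δ) ⟨0, hn⟩
    have h2 := hy ⟨0, hn⟩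
    have h3 : (y + diagVec n δ) ⟨0, hn⟩ = y ⟨0, hn⟩ + δ := rfl
    rw [h3, Real.norm_of_nonneg (by linarith)] at h1
    linarith
  have hr2 : r ≤ ‖y‖ + δ := by
    refine (norm_add_le _ _).trans ?_
    have : ‖diagVec n δ‖ ≤ δ := (pi_norm_le_iff_of_nonneg hδ.le).2 fun i => by
      simp [diagVec, abs_of_pos hδ]
    linarith
  have hr0 : 0 < r := hδ.trans_le hr1
  have hδm : 0 ≤ δ ^ m := Real.rpow_nonneg hδ.le m
  have hone : 1 ≤ (1 + r) ^ N := one_le_pow₀ (by linarith)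
  have key : 1 + r ^ m ≤ (2 + δ ^ m) * (1 + r) ^ N := by
    rcases le_total 0 m with hm | hm
    · have h1 : r ^ m ≤ (1 + r) ^ m := Real.rpow_le_rpow hr0.le (by linarith) hm
      have h2 : (1 + r) ^ m ≤ (1 + r) ^ (N : ℝ) :=
        Real.rpow_le_rpow_of_exponent_le (by linarith) ((le_abs_self m).trans hmN)
      rw [Real.rpow_natCast] at h2
      nlinarith
    · have h1 : r ^ m ≤ δ ^ m := Real.rpow_le_rpow_of_nonpos hδ hr1 hm
      nlinarith
  have h5 : (1 + r) ^ N ≤ ((1 + δ) * (1 + ‖y‖)) ^ N := by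
    gcongr
    nlinarith [mul_nonneg hδ.le (norm_nonneg y)]
  calc C * (1 + r ^ m) ≤ |C| * (1 + r ^ m) := by
        gcongr
        exact le_abs_self C
    _ ≤ |C| * ((2 + δ ^ m) * ((1 + δ) * (1 + ‖y‖)) ^ N) := by
        gcongr
        exact key.trans (by gcongr)
    _ = _ := by rw [mul_pow]; ring

theorem memTestClass_of {α : ℝ≥0} (hα0 : 0 < α) (hα1 : (α : ℝ) ≤ 1)
    (hf : ContDiffOn ℝ 4 f (posOrth n)) (hol : ∀ x ∈ posOrth n, LocHolder α 4 f x)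
    (hp : PolyBdd f) : MemTestClass n f where
  smooth := hf
  holder4 := by
    refine ⟨α, hα0, hα1, fun x hx => ?_⟩
    obtain ⟨s, hs, C, hC⟩ := hol x hx
    exact ⟨_, inter_mem hs ((isOpen_posOrth n).mem_nhds hx), inter_subset_right, C,
      hC.mono inter_subset_left⟩
  polyGrowth := hp.polyGrowth

/-- The translate of `f` by `(δ,…,δ)`, minus its first order Taylor polynomial at `x`. -/
def shiftGerm (f : (Fin n → ℝ) → ℝ) (x : Fin n → ℝ) (δ : ℝ) (y : Fin n → ℝ) : ℝ :=
  f (y + diagVec n δ)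
    + (-f (x + diagVec n δ) - fderiv ℝ f (x + diagVec n δ) (y - x))

variable {x y : Fin n → ℝ} {δ : ℝ}

theorem contDiff_affine {m : WithTop ℕ∞} (c : ℝ) (L : (Fin n → ℝ) →L[ℝ] ℝ) (x : Fin n → ℝ) :
    ContDiff ℝ m fun y => c - L (y - x) :=
  contDiff_const.sub (L.contDiff.comp (contDiff_id.sub contDiff_const))

theorem contDiffOn_comp_add_diagVec {m : WithTop ℕ∞} (hf : ContDiffOn ℝ m f (posOrth n))
    (hδ : 0 ≤ δ) : ContDiffOn ℝ m (fun y => f (y + diagVec n δ)) (posOrth n) :=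
  hf.comp (contDiff_id.add contDiff_const).contDiffOn fun _ hy => add_diagVec_mem hδ hy

theorem contDiffOn_shiftGerm (hf : ContDiffOn ℝ 4 f (posOrth n)) (hδ : 0 ≤ δ) :
    ContDiffOn ℝ 4 (shiftGerm f x δ) (posOrth n) :=
  (contDiffOn_comp_add_diagVec hf hδ).add (contDiff_affine _ _ _).contDiffOn

theorem fderiv_shiftGerm (hf : ContDiffOn ℝ 4 f (posOrth n)) (hδ : 0 ≤ δ) (hy : y ∈ posOrth n) :
    fderiv ℝ (shiftGerm f x δ) y
      = fderiv ℝ f (y + diagVec n δ) - fderiv ℝ f (x + diagVec n δ) := by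
  have h1 : HasFDerivAt f (fderiv ℝ f (y + diagVec n δ)) (y + diagVec n δ) :=
    ((contDiffAt_of_posOrth hf (add_diagVec_mem hδ hy)).differentiableAt (by simp)).hasFDerivAt
  have h2 : HasFDerivAt (fun y => f (y + diagVec n δ)) (fderiv ℝ f (y + diagVec n δ)) y := by
    have := h1.comp y ((hasFDerivAt_id y).add_const (diagVec n δ))
    rwa [ContinuousLinearMap.comp_id] at this
  have h3 := ((fderiv ℝ f (x + diagVec n δ)).hasFDerivAt (x := y - x)).comp y
    ((hasFDerivAt_id y).sub_const x)
  have h4 := h2.add (h3.const_sub (-f (x + diagVec n δ)))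
  have e : fderiv ℝ (shiftGerm f x δ) y = _ := h4.fderiv
  rw [e]
  ext v; simp [sub_eq_add_neg]

set_option maxSynthPendingDepth 3 in
theorem d2_shiftGerm (hf : ContDiffOn ℝ 4 f (posOrth n)) (hδ : 0 ≤ δ) (hy : y ∈ posOrth n) :
    d2 (shiftGerm f x δ) y = d2 f (y + diagVec n δ) := by
  have e : fderiv ℝ (shiftGerm f x δ) =ᶠ[𝓝 y] fun y =>
      fderiv ℝ f (y + diagVec n δ) - fderiv ℝ f (x + diagVec n δ) := by
    filter_upwards [(isOpen_posOrth n).mem_nhds hy] with y' hy' using fderiv_shiftGerm hf hδ hy'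
  rw [d2, e.fderiv_eq, fderiv_sub_const, fderiv_comp_add_right, d2]

theorem isGerm_shiftGerm (hf : ContDiffOn ℝ 4 f (posOrth n)) (hc : ConvexOn ℝ (posOrth n) f)
    (hx : x ∈ posOrth n) (hδ : 0 ≤ δ) {ε M : ℝ} (hε : 0 < ε)
    (hb : closedBall x (2 * ε) ⊆ posOrth n)
    (hM : ∀ y ∈ closedBall x (2 * ε), ‖d2 f (y + diagVec n δ)‖ ≤ M) :
    IsGerm (shiftGerm f x δ) x ε M where
  smooth := contDiffOn_shiftGerm hf hδ
  d2_nonneg y hy v := by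
    rw [d2_shiftGerm hf hδ hy]
    exact hc.d2_nonneg (isOpen_posOrth n) (hf.of_le (by norm_num)) (add_diagVec_mem hδ hy) v
  apply_eq := by simp [shiftGerm]
  fderiv_eq := by rw [fderiv_shiftGerm hf hδ hx, sub_self]
  eps_pos := hε
  ball_subset := hb
  norm_d2_le y hy := by rw [d2_shiftGerm hf hδ (hb hy)]; exact hM y hy

theorem MemTestClass.exists_locHolder (hf : MemTestClass n f) :
    ∃ α : ℝ≥0, 0 < α ∧ (α : ℝ) ≤ 1 ∧ ∀ x ∈ posOrth n, LocHolder α 4 f x := by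
  obtain ⟨α, h0, h1, h⟩ := hf.holder4
  refine ⟨α, h0, h1, fun x hx => ?_⟩
  obtain ⟨s, hs, -, C, hC⟩ := h x hx
  exact ⟨s, hs, C, hC⟩

theorem locHolder_shiftGerm {α : ℝ≥0} (hα : α ≤ 1) (hf : ContDiffOn ℝ 4 f (posOrth n))
    (h : ∀ x ∈ posOrth n, LocHolder α 4 f x) (hδ : 0 ≤ δ) (hy : y ∈ posOrth n) :
    LocHolder α 4 (shiftGerm f x δ) y :=
  LocHolder.add (LocHolder.comp_add_right (h _ (add_diagVec_mem hδ hy)))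
    (ContDiffAt.locHolder hα (contDiff_affine _ _ _).contDiffAt)
    (contDiffAt_of_posOrth (contDiffOn_comp_add_diagVec hf hδ) hy)
    (contDiff_affine _ _ _).contDiffAt

section Parts

variable {k χ : (Fin n → ℝ) → ℝ} {ε M X ρ C N : ℝ}

theorem locHolder_mul_add {α : ℝ≥0} (hα : α ≤ 1) {η κ : (Fin n → ℝ) → ℝ} (hη : ContDiff ℝ ∞ η)
    (hκ : ContDiff ℝ ∞ κ) (hg : ContDiffAt ℝ 4 g y) (h : LocHolder α 4 g y) :
    LocHolder α 4 (fun y => η y * g y + κ y) y := by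
  have hη5 : ContDiff ℝ (4 + 1 : ℕ) η := hη.of_le (WithTop.coe_le_coe.2 le_top)
  have hκ5 : ContDiff ℝ (4 + 1 : ℕ) κ := hκ.of_le (WithTop.coe_le_coe.2 le_top)
  have hη4 : ContDiff ℝ (4 : ℕ) η := hη.of_le (WithTop.coe_le_coe.2 le_top)
  have hκ4 : ContDiff ℝ (4 : ℕ) κ := hκ.of_le (WithTop.coe_le_coe.2 le_top)
  exact LocHolder.add
    (LocHolder.bilinear hα 4 (ContinuousLinearMap.mul ℝ ℝ) hη5.contDiffAt hg h)
    (hκ5.contDiffAt.locHolder hα) (hη4.contDiffAt.mul hg) hκ4.contDiffAt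

variable (hf : MemTestClass n f) (hχ : IsCutoff χ X) (hk : IsCompensator k ρ C)
include hf hχ hk

theorem memTestClass_localPart (hδ : 0 ≤ δ) (hg : IsGerm (shiftGerm f x δ) x ε M) :
    MemTestClass n (localPart k χ x ε (compConst M X) (shiftGerm f x δ)) := by
  obtain ⟨α, h0, h1, h⟩ := hf.exists_locHolder
  refine memTestClass_of h0 h1 (contDiffOn_localPart hg.smooth hχ hk) (fun y hy => ?_)
    (polyBdd_of_norm_d2_le ((contDiffOn_localPart hg.smooth hχ hk).of_le (by norm_num))
      (fun y hy => norm_d2_localPart_le hg hχ hk hy) hg.mem)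
  exact locHolder_mul_add h1 (contDiff_rescale hχ.smooth ε⁻¹ x)
    ((hk.contDiff_scaledComp x ε).const_smul _) (contDiffAt_of_posOrth hg.smooth hy)
    (locHolder_shiftGerm h1 hf.smooth h hδ hy)

set_option maxSynthPendingDepth 3 in
theorem memTestClass_farPart (hn : 0 < n) (hδ : 0 < δ) (hg : IsGerm (shiftGerm f x δ) x ε M) :
    MemTestClass n (farPart k χ x ε (compConst M X) (shiftGerm f x δ)) := by
  obtain ⟨α, h0, h1, h⟩ := hf.exists_locHolder
  have cq := contDiffOn_farPart (x := x) (ε := ε) (N := compConst M X) hg.smooth hχ hk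
  have cs := contDiffOn_comp_add_diagVec hf.smooth hδ.le
  refine memTestClass_of h0 h1 cq (fun y hy => ?_) ?_
  · have e : farPart k χ x ε (compConst M X) (shiftGerm f x δ) = fun y =>
        (1 - χ (ε⁻¹ • (y - x))) * shiftGerm f x δ y + compConst M X • scaledComp k x ε y := by
      funext y; rw [farPart, cut]; ring
    rw [e]
    exact locHolder_mul_add h1 (contDiff_const.sub (contDiff_rescale hχ.smooth ε⁻¹ x))
      ((hk.contDiff_scaledComp x ε).const_smul _) (contDiffAt_of_posOrth hg.smooth hy)
      (locHolder_shiftGerm h1 hf.smooth h hδ.le hy)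
  · have cr : ContDiffOn ℝ 2 (fun y => farPart k χ x ε (compConst M X) (shiftGerm f x δ) y
        - f (y + diagVec n δ)) (posOrth n) := (cq.sub cs).of_le (by norm_num)
    have e : farPart k χ x ε (compConst M X) (shiftGerm f x δ) = fun y =>
        (farPart k χ x ε (compConst M X) (shiftGerm f x δ) y - f (y + diagVec n δ))
          + f (y + diagVec n δ) := by
      funext y; ring
    rw [e]
    refine PolyBdd.add (polyBdd_of_norm_d2_le (M := (1 + 8 * X) * M + compConst M X * C) cr
      (fun y hy => ?_) hg.mem) (hf.polyBdd_comp_add hn hδ) cr (cs.of_le (by norm_num))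
    have t1 : TwiceDiffAt (farPart k χ x ε (compConst M X) (shiftGerm f x δ)) y :=
      ((contDiffAt_of_posOrth cq hy).of_le (by norm_num)).twiceDiffAt
    have t2 : TwiceDiffAt (fun y => f (y + diagVec n δ)) y :=
      ((contDiffAt_of_posOrth cs hy).of_le (by norm_num)).twiceDiffAt
    have t3 : d2 (fun y => f (y + diagVec n δ)) y = d2 (shiftGerm f x δ) y := by
      have e2 : fderiv ℝ (fun y => f (y + diagVec n δ))
          = fun y => fderiv ℝ f (y + diagVec n δ) := funext fun y => fderiv_comp_add_right _
      rw [d2_shiftGerm hf.smooth hδ.le hy, d2, e2, fderiv_comp_add_right, d2]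
    have hN := compConst_nonneg hg hχ
    rw [d2_sub t1 t2, t3, d2_farPart hg.smooth hχ hk hg.eps_pos hy]
    have e3 : ∀ a b c : (Fin n → ℝ) →L[ℝ] (Fin n → ℝ) →L[ℝ] ℝ, a - b + c - a = c - b := by
      intros; abel
    rw [e3, add_comm]
    refine (norm_sub_le _ _).trans (add_le_add ?_ (hg.norm_d2_cut_le hχ y))
    rw [norm_smul, Real.norm_of_nonneg hN]
    exact mul_le_mul_of_nonneg_left (hk.norm_d2_le _) hN

end Parts

end Growth

section Limit

variable {n : ℕ} {T t : ℝ} {x v : Fin n → ℝ} {f g : (Fin n → ℝ) → ℝ}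

theorem dir2_eq_d2_of_posOrth (hg : ContDiffOn ℝ 4 g (posOrth n)) (hx : x ∈ posOrth n)
    (v : Fin n → ℝ) : dir2 g x v = d2 g x v v :=
  dir2_eq_d2 ((contDiffAt_of_posOrth hg hx).of_le (by norm_num)).twiceDiffAt.2 v

theorem ConvexOn.d2_apply_eq_zero (hc : ConvexOn ℝ (posOrth n) g)
    (hg : ContDiffOn ℝ 4 g (posOrth n)) (hx : x ∈ posOrth n) (hv : dir2 g x v = 0)
    (p : Fin n → ℝ) : d2 g x v p = 0 :=
  d2_apply_eq_zero_of_degenerate ((contDiffAt_of_posOrth hg hx).of_le (by norm_num))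
    (fun w => hc.d2_nonneg (isOpen_posOrth n) (hg.of_le (by norm_num)) hx w)
    (by rw [← dir2_eq_d2_of_posOrth hg hx, hv]) p

theorem ConvexOn.d2_fderiv_eq_zero (hc : ConvexOn ℝ (posOrth n) g)
    (hg : ContDiffOn ℝ 4 g (posOrth n)) (hx : x ∈ posOrth n) (hv : dir2 g x v = 0)
    (p : Fin n → ℝ) : d2 (fderiv ℝ g) x v v p = 0 :=
  d2_fderiv_eq_zero_of_degenerate (contDiffAt_of_posOrth hg hx)
    (((isOpen_posOrth n).eventually_mem hx).mono
      fun _ hy => hc.d2_nonneg (isOpen_posOrth n) (hg.of_le (by norm_num)) hy v)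
    (by rw [← dir2_eq_d2_of_posOrth hg hx, hv]) p

theorem ConvexOn.dir2_Bop_eq (hc : ConvexOn ℝ (posOrth n) g) (K : JumpKernel n T) (lam : ℝ → ℝ)
    (hg : ContDiffOn ℝ 4 g (posOrth n)) (hx : x ∈ posOrth n) (ht : t ∈ Icc (0:ℝ) T)
    (hv : dir2 g x v = 0) :
    dir2 (fun y => Bop lam K g y t) x v
      = lam t * ∫ z in Icc (0:ℝ) 1, jumpForm (fun y z => K.φ y t z) g x v z :=
  dir2_Bop K lam hx ht hg (hc.d2_apply_eq_zero hg hx hv) (hc.d2_fderiv_eq_zero hg hx hv)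

variable {ψ : (Fin n → ℝ) → ℝ → Fin n → ℝ} {r P : ℝ} {a b : Fin n → ℝ}

theorem JumpJet.aestronglyMeasurable_jumpForm (h : JumpJet ψ x r P a b)
    (hc : ConvexOn ℝ (posOrth n) g) (hg : ContDiffOn ℝ 4 g (posOrth n)) (hv : dir2 g x v = 0) :
    AEStronglyMeasurable (jumpForm ψ g x v) (volume.restrict (Icc (0:ℝ) 1)) :=
  have hx := h.mem_posOrth (mem_ball_self h.r_pos)
  (h.d2_integral_eq hg (hc.d2_apply_eq_zero hg hx hv) (hc.d2_fderiv_eq_zero hg hx hv)).2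

set_option maxSynthPendingDepth 3 in
theorem JumpJet.norm_jumpForm_le (h : JumpJet ψ x r P a b) {M : ℝ} (hM : 0 ≤ M)
    (h2 : ∀ y ∈ Icc a b, ‖d2 g y‖ ≤ M) (h1 : ∀ y ∈ Icc a b, ‖fderiv ℝ g y‖ ≤ M) {z : ℝ}
    (hz : z ∈ Icc (0:ℝ) 1) :
    ‖jumpForm ψ g x v z‖ ≤ M * (‖v‖ + P * ‖v‖) * (‖v‖ + P * ‖v‖) + M * (P * ‖v‖ * ‖v‖)
      + M * (P * ‖v‖ * ‖v‖) := by
  have hx := mem_ball_self (x := x) h.r_pos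
  have hP := h.P_nonneg
  have hy := h.jump_mem_box z hz x hx
  have e1 : ‖v + fderiv ℝ (fun y => ψ y z) x v‖ ≤ ‖v‖ + P * ‖v‖ :=
    (norm_add_le _ _).trans (add_le_add le_rfl
      (ContinuousLinearMap.le_of_opNorm_le _ (h.norm_fderiv_le z hz x hx) v))
  have e2 : ‖d2 (fun y => ψ y z) x v v‖ ≤ P * ‖v‖ * ‖v‖ :=
    ((d2 (fun y => ψ y z) x).le_opNorm₂ v v).trans (by
      have := h.norm_d2_le z hz x hx
      gcongr)
  refine (norm_sub_le _ _).trans (add_le_add ((norm_add_le _ _).trans (add_le_add ?_ ?_)) ?_)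
  · exact ((d2 g _).le_opNorm₂ _ _).trans (by
      have := h2 _ hy
      gcongr)
  · exact ((fderiv ℝ g _).le_opNorm _).trans (by
      have := h1 _ hy
      gcongr)
  · exact ((fderiv ℝ g _).le_opNorm _).trans (by
      have := h1 _ (h.mem_box x hx)
      gcongr)

theorem tendsto_clm_apply {E F ι : Type*} [NormedAddCommGroup E] [NormedSpace ℝ E]
    [NormedAddCommGroup F] [NormedSpace ℝ F] {A : ι → E →L[ℝ] F} {A₀ : E →L[ℝ] F} {l : Filter ι}
    (h : Tendsto A l (𝓝 A₀)) (v : E) : Tendsto (fun i => A i v) l (𝓝 (A₀ v)) :=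
  ((ContinuousLinearMap.apply ℝ F v).continuous.tendsto A₀).comp h

theorem JumpJet.tendsto_integral_jumpForm (h : JumpJet ψ x r P a b)
    (h0 : ∀ᵐ z ∂(volume.restrict (Icc (0:ℝ) 1)), ψ x z ≠ 0) {q : ℝ → (Fin n → ℝ) → ℝ}
    {M : ℝ} (hM : 0 ≤ M) {L : (Fin n → ℝ) →L[ℝ] ℝ}
    (hm : ∀ᶠ ε in 𝓝[>] (0:ℝ),
      AEStronglyMeasurable (jumpForm ψ (q ε) x v) (volume.restrict (Icc (0:ℝ) 1)))
    (hb : ∀ᶠ ε in 𝓝[>] (0:ℝ), ∀ y ∈ Icc a b, ‖d2 (q ε) y‖ ≤ M ∧ ‖fderiv ℝ (q ε) y‖ ≤ M)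
    (l2 : ∀ y ∈ Icc a b, y ≠ x → Tendsto (fun ε => d2 (q ε) y) (𝓝[>] 0) (𝓝 (d2 g y)))
    (l1 : ∀ y ∈ Icc a b,
      Tendsto (fun ε => fderiv ℝ (q ε) y) (𝓝[>] 0) (𝓝 (fderiv ℝ g y + L))) :
    Tendsto (fun ε => ∫ z in Icc (0:ℝ) 1, jumpForm ψ (q ε) x v z) (𝓝[>] 0)
      (𝓝 (∫ z in Icc (0:ℝ) 1, jumpForm ψ g x v z)) := by
  have hx := mem_ball_self (x := x) h.r_pos
  have hI : ∀ᵐ z ∂(volume.restrict (Icc (0:ℝ) 1)), z ∈ Icc (0:ℝ) 1 :=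
    ae_restrict_mem measurableSet_Icc
  refine tendsto_integral_filter_of_dominated_convergence _ hm
    (hb.mono fun ε hε => hI.mono fun z hz => h.norm_jumpForm_le hM (fun y hy => (hε y hy).1)
      (fun y hy => (hε y hy).2) hz) (integrable_const _) ?_
  filter_upwards [hI, h0] with z hz hz0
  have hy := h.jump_mem_box z hz x hx
  have t := ((tendsto_clm_apply (tendsto_clm_apply (l2 _ hy (by simpa using hz0))
    (v + fderiv ℝ (fun y => ψ y z) x v)) (v + fderiv ℝ (fun y => ψ y z) x v)).add
    (tendsto_clm_apply (l1 _ hy) (d2 (fun y => ψ y z) x v v))).sub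
    (tendsto_clm_apply (l1 _ (h.mem_box x hx)) (d2 (fun y => ψ y z) x v v))
  convert t using 2
  · rw [jumpForm]
  · rw [jumpForm, _root_.add_apply, _root_.add_apply]
    ring

theorem JumpJet.closedBall_subset (h : JumpJet ψ x r P a b) {ε : ℝ} (hε : 2 * ε < r) :
    closedBall x (2 * ε) ⊆ Icc a b := fun _ hy =>
  h.mem_box _ (closedBall_subset_ball hε hy)

theorem JumpJet.eventually_lt (h : JumpJet ψ x r P a b) :
    ∀ᶠ ε in 𝓝[>] (0:ℝ), 0 < ε ∧ 2 * ε < r ∧ ε ≤ 1 := by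
  have : 0 < min (r / 2) 1 := lt_min (half_pos h.r_pos) one_pos
  filter_upwards [Ioo_mem_nhdsGT this] with ε hε
  have := lt_min_iff.1 hε.2
  exact ⟨hε.1, by linarith [this.1], this.2.le⟩

@[simp] theorem diagVec_zero (n : ℕ) : diagVec n 0 = 0 := rfl

theorem tendsto_diagVec (n : ℕ) : Tendsto (diagVec n) (𝓝[>] 0) (𝓝 0) :=
  tendsto_pi_nhds.2 fun _ => tendsto_nhdsWithin_of_tendsto_nhds tendsto_id

theorem add_diagVec_mem_Icc {y : Fin n → ℝ} {δ : ℝ} (hy : y ∈ Icc a b) (h0 : 0 ≤ δ) (h1 : δ ≤ 1) :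
    y + diagVec n δ ∈ Icc a (b + diagVec n 1) :=
  ⟨fun i => (hy.1 i).trans (le_add_of_nonneg_right h0), fun i => add_le_add (hy.2 i) h1⟩

end Limit

section Main

variable {n : ℕ} {T t : ℝ} {x v : Fin n → ℝ} {f : (Fin n → ℝ) → ℝ}
  {K : JumpKernel n T} {Dk : DiffKernel n T} {lam : ℝ → ℝ}

set_option maxSynthPendingDepth 3 in
theorem isLCPAt_Aop_of_add (hK : K.AENonzero) (hx : x ∈ posOrth n) (ht : t ∈ Icc (0:ℝ) T)
    (h : IsLCPAt (fun g y s => Aop Dk g y s + Bop lam K g y s) x t) : IsLCPAt (Aop Dk) x t := by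
  intro v hv f hf hc hfv
  obtain ⟨r, P, a, b, hj⟩ := K.exists_jumpJet hx ht
  obtain ⟨χ, X, hχ⟩ := exists_isCutoff n
  obtain ⟨k, ρ, C, hk⟩ := exists_isCompensator n
  obtain ⟨M, -, hM⟩ := exists_jet_bound (b := b) hf.smooth hj.a_pos
  have hsub := Icc_subset_posOrth (b := b) hj.a_pos
  set N := compConst M X
  set F := shiftGerm f x 0
  set q : ℝ → (Fin n → ℝ) → ℝ := fun ε => localPart k χ x ε N F with hq
  set K1 := (1 + 8 * X) * M + N * C with hK1
  set K2 := (2 + 4 * X) * M + N * C with hK2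
  have hF : ∀ y ∈ posOrth n, fderiv ℝ F y = fderiv ℝ f y + -fderiv ℝ f x := by
    intro y hy
    have := fderiv_shiftGerm (x := x) hf.smooth le_rfl hy
    rwa [diagVec_zero, add_zero, add_zero, sub_eq_add_neg] at this
  have hF2 : d2 F x = d2 f x := by
    have := d2_shiftGerm (x := x) hf.smooth le_rfl hx
    rwa [diagVec_zero, add_zero] at this
  have germ : ∀ᶠ ε in 𝓝[>] (0:ℝ), IsGerm F x ε M := by
    filter_upwards [hj.eventually_lt] with ε hε
    have hcb := hj.closedBall_subset hε.2.1
    refine isGerm_shiftGerm hf.smooth hc hx le_rfl hε.1 (hcb.trans hsub) fun y hy => ?_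
    rw [diagVec_zero, add_zero]
    exact (hM y (hcb hy)).2.2.1
  have smooth : ∀ᶠ ε in 𝓝[>] (0:ℝ), ContDiffOn ℝ 4 (q ε) (posOrth n) :=
    germ.mono fun ε hg => contDiffOn_localPart hg.smooth hχ hk
  have conv : ∀ᶠ ε in 𝓝[>] (0:ℝ), ConvexOn ℝ (posOrth n) (q ε) :=
    germ.mono fun ε hg => convexOn_localPart hg hχ hk
  have deg : ∀ᶠ ε in 𝓝[>] (0:ℝ), dir2 (q ε) x v = 0 := by
    filter_upwards [germ, smooth] with ε hg hs
    rw [dir2_eq_d2_of_posOrth hs hx, d2_congr (localPart_eventuallyEq hχ hk hg.eps_pos), hF2,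
      ← dir2_eq_d2_of_posOrth hf.smooth hx, hfv]
  have ineq : ∀ᶠ ε in 𝓝[>] (0:ℝ), 0 ≤ dir2 (fun y => Aop Dk f y t) x v
      + lam t * ∫ z in Icc (0:ℝ) 1, jumpForm (fun y z => K.φ y t z) (q ε) x v z := by
    filter_upwards [germ, smooth, conv, deg] with ε hg hs hcε hd
    have h1 := h v hv (q ε) (memTestClass_localPart hf hχ hk le_rfl hg) hcε hd
    have e : dir2 (fun y => Aop Dk (q ε) y t) x v = dir2 (fun y => Aop Dk f y t) x v := by
      refine dir2_Aop_congr Dk (L := -fderiv ℝ f x) ?_ v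
      filter_upwards [(localPart_eventuallyEq (f := F) (N := N) hχ hk hg.eps_pos).fderiv (𝕜 := ℝ),
        (isOpen_posOrth n).mem_nhds hx] with y hy hyO
      rw [← hF y hyO]
      exact hy
    rwa [dir2_Aop_add_Bop K Dk lam hx ht hs, e, hcε.dir2_Bop_eq K lam hs hx ht hd] at h1
  have hbd : ∀ᶠ ε in 𝓝[>] (0:ℝ), ∀ y ∈ Icc a b, ‖d2 (q ε) y‖ ≤ K1 ∧ ‖fderiv ℝ (q ε) y‖ ≤ K2 * ε :=
    germ.mono fun ε hg y hy =>
      ⟨norm_d2_localPart_le hg hχ hk (hsub hy), norm_fderiv_localPart_le hg hχ hk (hsub hy)⟩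
  have lim := hj.tendsto_integral_jumpForm (v := v) (g := fun _ => 0) (L := 0) (q := q)
    (M := |K1| + |K2|) (hK x hx t ht) (by positivity)
    (by
      filter_upwards [smooth, conv, deg] with ε hs hcε hd
      exact hj.aestronglyMeasurable_jumpForm hcε hs hd)
    (by
      filter_upwards [hbd, hj.eventually_lt] with ε h1 h2 y hy
      refine ⟨((h1 y hy).1.trans (le_abs_self _)).trans (by simp), (h1 y hy).2.trans ?_⟩
      nlinarith [le_abs_self K2, abs_nonneg K2, abs_nonneg K1, h2.1, h2.2.2])
    (by
      intro y hy hyx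
      refine tendsto_const_nhds.congr' ?_
      filter_upwards [germ, eventually_d2_cut_eq_zero hχ (fun _ => F) hyx, hk.ray (y - x)]
        with ε hg h1 h2
      rw [hq, d2_localPart hg.smooth hχ hk hg.eps_pos (hsub hy), h1, h2]
      simp [d2])
    (by
      intro y hy
      have e : fderiv ℝ (fun _ : Fin n → ℝ => (0:ℝ)) y + 0 = 0 := by simp
      rw [e]
      refine squeeze_zero_norm' (hbd.mono fun ε h1 => (h1 y hy).2) ?_
      have : Tendsto (fun ε : ℝ => K2 * ε) (𝓝 0) (𝓝 (K2 * 0)) := tendsto_id.const_mul K2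
      rw [mul_zero] at this
      exact tendsto_nhdsWithin_of_tendsto_nhds this)
  have e0 : ∀ z, jumpForm (fun y z => K.φ y t z) (fun _ => (0:ℝ)) x v z = 0 := by
    intro z; simp [jumpForm, d2]
  simp only [e0, integral_zero] at lim
  have := ge_of_tendsto ((lim.const_mul (lam t)).const_add _) ineq
  simpa using this

set_option maxSynthPendingDepth 3 in
theorem isLCPAt_Bop_of_add (hK : K.AENonzero) (hx : x ∈ posOrth n) (ht : t ∈ Icc (0:ℝ) T)
    (h : IsLCPAt (fun g y s => Aop Dk g y s + Bop lam K g y s) x t) : IsLCPAt (Bop lam K) x t := by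
  intro v hv f hf hc hfv
  have hn : 0 < n := by
    rcases n.eq_zero_or_pos with rfl | hn
    · exact absurd (Subsingleton.elim v 0) hv
    · exact hn
  obtain ⟨r, P, a, b, hj⟩ := K.exists_jumpJet hx ht
  obtain ⟨χ, X, hχ⟩ := exists_isCutoff n
  obtain ⟨k, ρ, C, hk⟩ := exists_isCompensator n
  obtain ⟨M, hM0, hM⟩ := exists_jet_bound (b := b + diagVec n 1) hf.smooth hj.a_pos
  have hsub := Icc_subset_posOrth (b := b) hj.a_pos
  have hxI : x ∈ Icc a b := hj.mem_box x (mem_ball_self hj.r_pos)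
  set N := compConst M X
  set F : ℝ → (Fin n → ℝ) → ℝ := fun ε => shiftGerm f x ε with hF
  set q : ℝ → (Fin n → ℝ) → ℝ := fun ε => farPart k χ x ε N (F ε) with hq
  set K1 := M + (1 + 8 * X) * M + N * C with hK1
  set K2 := (2 + 4 * X) * M + N * C with hK2
  have germ : ∀ᶠ ε in 𝓝[>] (0:ℝ), IsGerm (F ε) x ε M := by
    filter_upwards [hj.eventually_lt] with ε hε
    have hcb := hj.closedBall_subset hε.2.1
    exact isGerm_shiftGerm hf.smooth hc hx hε.1.le hε.1 (hcb.trans hsub) fun y hy =>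
      (hM _ (add_diagVec_mem_Icc (hcb hy) hε.1.le hε.2.2)).2.2.1
  have smooth : ∀ᶠ ε in 𝓝[>] (0:ℝ), ContDiffOn ℝ 4 (q ε) (posOrth n) :=
    germ.mono fun ε hg => contDiffOn_farPart hg.smooth hχ hk
  have conv : ∀ᶠ ε in 𝓝[>] (0:ℝ), ConvexOn ℝ (posOrth n) (q ε) :=
    germ.mono fun ε hg => convexOn_farPart hg hχ hk
  have deg : ∀ᶠ ε in 𝓝[>] (0:ℝ), dir2 (q ε) x v = 0 := by
    filter_upwards [germ, smooth] with ε hg hs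
    rw [dir2_eq_d2_of_posOrth hs hx, d2_congr (farPart_eventuallyEq hχ hk hg.eps_pos)]
    simp [d2]
  have ineq : ∀ᶠ ε in 𝓝[>] (0:ℝ),
      0 ≤ lam t * ∫ z in Icc (0:ℝ) 1, jumpForm (fun y z => K.φ y t z) (q ε) x v z := by
    filter_upwards [germ, smooth, conv, deg] with ε hg hs hcε hd
    have h1 := h v hv (q ε) (memTestClass_farPart hf hχ hk hn hg.eps_pos hg) hcε hd
    have e : dir2 (fun y => Aop Dk (q ε) y t) x v = 0 := by
      refine dir2_Aop_eq_zero Dk ?_ v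
      filter_upwards [(farPart_eventuallyEq (f := F ε) (N := N) hχ hk hg.eps_pos).fderiv (𝕜 := ℝ)]
        with y hy
      rw [hq, hy]
      simp
    rwa [dir2_Aop_add_Bop K Dk lam hx ht hs, e, zero_add, hcε.dir2_Bop_eq K lam hs hx ht hd] at h1
  have hD : ∀ᶠ ε in 𝓝[>] (0:ℝ), ∀ y ∈ Icc a b, ‖fderiv ℝ (q ε) y - fderiv ℝ (F ε) y‖ ≤ K2 * ε :=
    germ.mono fun ε hg y hy => norm_fderiv_farPart_sub_le hg hχ hk (hsub hy)
  have cf1 : ∀ y ∈ posOrth n, ContinuousAt (fderiv ℝ f) y := fun y hy =>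
    ((contDiffAt_of_posOrth hf.smooth hy).fderiv_right (m := 3) (by norm_num)).continuousAt
  have cf2 : ∀ y ∈ posOrth n, ContinuousAt (d2 f) y := fun y hy =>
    (((contDiffAt_of_posOrth hf.smooth hy).fderiv_right (m := 3) (by norm_num)).fderiv_right
      (m := 2) (by norm_num)).continuousAt
  have shift : ∀ y : Fin n → ℝ, Tendsto (fun ε => y + diagVec n ε) (𝓝[>] 0) (𝓝 y) := fun y => by
    simpa using (tendsto_diagVec n).const_add y
  have lim := hj.tendsto_integral_jumpForm (v := v) (g := f) (L := -fderiv ℝ f x) (q := q)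
    (M := |K1| + (M + M + |K2|)) (hK x hx t ht) (by positivity)
    (by
      filter_upwards [smooth, conv, deg] with ε hs hcε hd
      exact hj.aestronglyMeasurable_jumpForm hcε hs hd)
    (by
      filter_upwards [germ, hD, hj.eventually_lt] with ε hg h1 h2 y hy
      have b1 := hM _ (add_diagVec_mem_Icc hy h2.1.le h2.2.2)
      have b2 := hM _ (add_diagVec_mem_Icc hxI h2.1.le h2.2.2)
      constructor
      · have := norm_d2_farPart_le hg hχ hk (hsub hy)
        rw [hF, d2_shiftGerm hf.smooth h2.1.le (hsub hy)] at this
        linarith [le_abs_self K1, abs_nonneg K2, b1.2.2.1]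
      · have e1 := norm_sub_norm_le (fderiv ℝ (q ε) y) (fderiv ℝ (F ε) y)
        have e2 := norm_sub_le (fderiv ℝ f (y + diagVec n ε)) (fderiv ℝ f (x + diagVec n ε))
        rw [← fderiv_shiftGerm hf.smooth h2.1.le (hsub hy)] at e2
        have e3 : K2 * ε ≤ |K2| := by nlinarith [le_abs_self K2, abs_nonneg K2, h2.1, h2.2.2]
        linarith [h1 y hy, b1.2.1, b2.2.1, abs_nonneg K1])
    (by
      intro y hy hyx
      refine ((cf2 y (hsub hy)).tendsto.comp (shift y)).congr' ?_
      filter_upwards [germ, eventually_d2_cut_eq_zero hχ F hyx, hk.ray (y - x)] with ε hg h1 h2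
      rw [hq, d2_farPart hg.smooth hχ hk hg.eps_pos (hsub hy), h1, h2, hF,
        d2_shiftGerm hf.smooth hg.eps_pos.le (hsub hy)]
      simp)
    (by
      intro y hy
      have l1 : Tendsto (fun ε => fderiv ℝ (q ε) y - fderiv ℝ (F ε) y) (𝓝[>] 0) (𝓝 0) := by
        refine squeeze_zero_norm' (hD.mono fun ε h1 => h1 y hy) ?_
        have : Tendsto (fun ε : ℝ => K2 * ε) (𝓝 0) (𝓝 (K2 * 0)) := tendsto_id.const_mul K2
        rw [mul_zero] at this
        exact tendsto_nhdsWithin_of_tendsto_nhds this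
      have l2 : Tendsto (fun ε => fderiv ℝ (F ε) y) (𝓝[>] 0)
          (𝓝 (fderiv ℝ f y - fderiv ℝ f x)) := by
        refine (((cf1 y (hsub hy)).tendsto.comp (shift y)).sub
          ((cf1 x hx).tendsto.comp (shift x))).congr' ?_
        filter_upwards [germ] with ε hg
        exact (fderiv_shiftGerm hf.smooth hg.eps_pos.le (hsub hy)).symm
      simpa [sub_eq_add_neg] using l1.add l2)
  rw [hc.dir2_Bop_eq K lam hf.smooth hx ht hfv]
  exact ge_of_tendsto (lim.const_mul (lam t)) ineq

theorem isLCPAt_add (hx : x ∈ posOrth n) (ht : t ∈ Icc (0:ℝ) T) (hA : IsLCPAt (Aop Dk) x t)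
    (hB : IsLCPAt (Bop lam K) x t) :
    IsLCPAt (fun g y s => Aop Dk g y s + Bop lam K g y s) x t := fun v hv f hf hc hfv => by
  rw [dir2_Aop_add_Bop K Dk lam hx ht hf.smooth]
  exact add_nonneg (hA v hv f hf hc hfv) (hB v hv f hf hc hfv)

end Main

end

/-- (Part of Theorem 4.2): the operator `M = A + B` is LCP at all points
`(x,t) ∈ (0,∞)ⁿ × [0,T]` if and only if both `A` and `B` are LCP at all points. -/
theorem lcp_M_iff_lcp_A_and_lcp_B {n : ℕ} {T : ℝ} (hT : 0 < T)
    (K : JumpKernel n T) (hK : K.AENonzero)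
    (Dk : DiffKernel n T)
    (lam : ℝ → ℝ) (hlam : LamOK T lam) :
    (∀ x ∈ posOrth n, ∀ t ∈ Set.Icc (0:ℝ) T,
        IsLCPAt (fun g y s => Aop Dk g y s + Bop lam K g y s) x t) ↔
      ((∀ x ∈ posOrth n, ∀ t ∈ Set.Icc (0:ℝ) T, IsLCPAt (Aop Dk) x t) ∧
        (∀ x ∈ posOrth n, ∀ t ∈ Set.Icc (0:ℝ) T, IsLCPAt (Bop lam K) x t)) := by
  refine ⟨fun h => ⟨fun x hx t ht => isLCPAt_Aop_of_add hK hx ht (h x hx t ht),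
    fun x hx t ht => isLCPAt_Bop_of_add hK hx ht (h x hx t ht)⟩,
    fun h x hx t ht => isLCPAt_add hx ht (h.1 x hx t ht) (h.2 x hx t ht)⟩

end
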